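/- Let K be a field of arbitrary characteristic and let (A, A') be a deletion pair of affine line arrangements in K², i.e. A' ⊂ A and |A'| + 1 = |A|. Then both A and A' are free if and only if the characteristic polynomials χ(A,t) and χ(A',t) have a common root in ℂ. -/

import Mathlib

open MvPolynomial

variable {K : Type*} [Field K]

/-- A subset of `K × K` is an affine line: the zero set of a nonzero degree-one equation. -/
def IsAffineLine (L : Set (K × K)) : Prop :=
  ∃ a b c : K, (a, b) ≠ (0, 0) ∧ L = {p : K × K | a * p.1 + b * p.2 + c = 0}

/-- An affine line arrangement: a finite set of affine lines in `K²`. -/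
def IsLineArr (A : Finset (Set (K × K))) : Prop :=
  ∀ L ∈ A, IsAffineLine L

open Classical in
/-- The second Betti number `b₂(A)` of a line arrangement, via Whitney's theorem:
`b₂(A) = ∑ (-1)^{|B|}` over the subsets `B ⊆ A` with `|B| ≥ 2` and `⋂ B ≠ ∅`. -/
noncomputable def b2 (A : Finset (Set (K × K))) : ℤ :=
  ∑ B ∈ A.powerset.filter
      (fun B : Finset (Set (K × K)) => 2 ≤ B.card ∧ (⋂ L ∈ B, (L : Set (K × K))).Nonempty),
    (-1 : ℤ) ^ B.card

/-- The characteristic polynomial `χ(A,t) = t² − |A|·t + b₂(A)`, evaluated at `t : ℂ`. -/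
noncomputable def chi (A : Finset (Set (K × K))) (t : ℂ) : ℂ :=
  t ^ 2 - (A.card : ℂ) * t + (b2 A : ℂ)

/-- `nOn A H = |A ∩ H|`: the number of intersection points, lying on the line `H`, of `H`
with the lines of `A` other than `H`. -/
noncomputable def nOn (A : Finset (Set (K × K))) (H : Set (K × K)) : ℕ :=
  Set.ncard {p : K × K | p ∈ H ∧ ∃ L ∈ A, L ≠ H ∧ p ∈ L}

/-- The linear form `a·x + b·y + c·z` in `K[x,y,z]`. -/
noncomputable def lin3 (a b c : K) : MvPolynomial (Fin 3) K :=
  C a * X 0 + C b * X 1 + C c * X 2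

/-- The action on `f` of the derivation with coefficient vector `θ`. -/
noncomputable def applyDer3 (θ : Fin 3 → MvPolynomial (Fin 3) K)
    (f : MvPolynomial (Fin 3) K) : MvPolynomial (Fin 3) K :=
  ∑ i, θ i * pderiv i f

/-- `θ` belongs to `D(cA)`, the logarithmic derivation module of the cone of `A`:
`θ(α_H) ∈ S·α_H` for every `H ∈ cA`, where `cA` consists of the homogenizations of the
lines of `A` together with the plane `z = 0`. -/
def InDCone (A : Finset (Set (K × K))) (θ : Fin 3 → MvPolynomial (Fin 3) K) : Prop :=
  (∀ L ∈ A, ∀ a b c : K, (a, b) ≠ (0, 0) →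
      L = {p : K × K | a * p.1 + b * p.2 + c = 0} →
      ∃ g, applyDer3 θ (lin3 a b c) = g * lin3 a b c) ∧
  (∃ g, applyDer3 θ (X 2) = g * (X 2 : MvPolynomial (Fin 3) K))

/-- A homogeneous derivation of degree `d` on `K[x,y,z]`. -/
def HomogDer3 (θ : Fin 3 → MvPolynomial (Fin 3) K) (d : ℕ) : Prop :=
  ∀ i, (θ i).IsHomogeneous d

/-- `A` is free with exponents `exp₀(A) = (d₁, d₂)`: `D(cA)` is a free module with a
homogeneous basis consisting of the Euler derivation `x∂ₓ + y∂_y + z∂_z` and two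
derivations of degrees `d₁` and `d₂`. -/
def IsFreeExp (A : Finset (Set (K × K))) (d₁ d₂ : ℕ) : Prop :=
  ∃ θ₁ θ₂ : Fin 3 → MvPolynomial (Fin 3) K,
    InDCone A θ₁ ∧ InDCone A θ₂ ∧ HomogDer3 θ₁ d₁ ∧ HomogDer3 θ₂ d₂ ∧
    ∀ θ : Fin 3 → MvPolynomial (Fin 3) K, InDCone A θ →
      ∃! cfs : MvPolynomial (Fin 3) K × MvPolynomial (Fin 3) K × MvPolynomial (Fin 3) K,
        θ = fun j => cfs.1 * X j + cfs.2.1 * θ₁ j + cfs.2.2 * θ₂ j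

/-- `A` is free (with some exponents). -/
def IsFree (A : Finset (Set (K × K))) : Prop := ∃ d₁ d₂ : ℕ, IsFreeExp A d₁ d₂

/-- `A` is free with (integer-valued) exponents `exp₀(A) = (d₁, d₂)`. -/
def IsFreeExpZ (A : Finset (Set (K × K))) (d₁ d₂ : ℤ) : Prop :=
  ∃ e₁ e₂ : ℕ, (e₁ : ℤ) = d₁ ∧ (e₂ : ℤ) = d₂ ∧ IsFreeExp A e₁ e₂

/-! ### Homogeneous polynomials -/

section Homogeneous

variable {σ R : Type*} [CommRing R]

theorem homogeneousComponent_add_mul {f : MvPolynomial σ R} {m : ℕ} (hf : f.IsHomogeneous m)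
    (g : MvPolynomial σ R) (k : ℕ) :
    homogeneousComponent (m + k) (f * g) = f * homogeneousComponent k g := by
  conv_lhs => rw [← sum_homogeneousComponent g, Finset.mul_sum, map_sum]
  have h (i : ℕ) : homogeneousComponent (m + k) (f * homogeneousComponent i g) =
      if i = k then f * homogeneousComponent k g else 0 := by
    rw [homogeneousComponent_of_mem (hf.mul (homogeneousComponent_isHomogeneous i g))]
    by_cases hik : i = k
    · simp [hik]
    · rw [if_neg (by omega), if_neg hik]
  simp_rw [h]
  rw [Finset.sum_ite_eq']
  split_ifs with hk
  · rfl
  · rw [homogeneousComponent_eq_zero, mul_zero]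
    simpa using hk

theorem homogeneousComponent_mul_of_lt {f : MvPolynomial σ R} {m : ℕ} (hf : f.IsHomogeneous m)
    (g : MvPolynomial σ R) {k : ℕ} (hk : k < m) : homogeneousComponent k (f * g) = 0 := by
  conv_lhs => rw [← sum_homogeneousComponent g, Finset.mul_sum, map_sum]
  refine Finset.sum_eq_zero fun i _ => ?_
  rw [homogeneousComponent_of_mem (hf.mul (homogeneousComponent_isHomogeneous i g)),
    if_neg (by omega)]

theorem MvPolynomial.IsHomogeneous.of_mul_left [IsDomain R] {f g : MvPolynomial σ R} {m k : ℕ}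
    (hf : f.IsHomogeneous m) (hf0 : f ≠ 0) (hfg : (f * g).IsHomogeneous (m + k)) :
    g.IsHomogeneous k := by
  have h := homogeneousComponent_add_mul hf g k
  rw [homogeneousComponent_eq_self hfg] at h
  rw [mul_left_cancel₀ hf0 h]
  exact homogeneousComponent_isHomogeneous k g

theorem aeval_mul_left_of_isHomogeneous {B : Type*} [CommRing B] [Algebra R B]
    {f : MvPolynomial σ R} {k : ℕ} (hf : f.IsHomogeneous k) (z : B) (x : σ → B) :
    aeval (fun i => z * x i) f = z ^ k * aeval x f := by
  rw [aeval_def, aeval_def, eval₂_eq, eval₂_eq, Finset.mul_sum]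
  refine Finset.sum_congr rfl fun d hd => ?_
  have hk : ∑ i ∈ d.support, d i = k := by
    simpa [Finsupp.degree] using (hf.degree_eq_sum_deg_support hd).symm
  simp_rw [mul_pow]
  rw [Finset.prod_mul_distrib, Finset.prod_pow_eq_pow_sum, hk]
  ring

end Homogeneous

instance (k : ℕ) : FiniteDimensional K (homogeneousSubmodule (Fin 3) K k) :=
  Module.Finite.iff_fg.mpr (homogeneousSubmodule_fg _ _ k)

theorem finrank_homogeneousSubmodule_fin_three (k : ℕ) :
    Module.finrank K (homogeneousSubmodule (Fin 3) K k) = (k + 2).choose 2 := by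
  classical
  have hs : {d : Fin 3 →₀ ℕ | d.degree = k} =
      ((Finset.univ : Finset (Fin 3)).finsuppAntidiag k : Set (Fin 3 →₀ ℕ)) := by
    ext d
    simp [Finset.mem_finsuppAntidiag, Finsupp.degree_eq_sum]
  have e : homogeneousSubmodule (Fin 3) K k ≃ₗ[K]
      (((Finset.univ : Finset (Fin 3)).finsuppAntidiag k : Set (Fin 3 →₀ ℕ)) →₀ K) := by
    rw [← hs, homogeneousSubmodule_eq_finsupp_supported]
    exact AddMonoidAlgebra.supportedEquivFinsupp (R := K) (S := K) _
  rw [e.finrank_eq, Module.finrank_finsupp_self]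
  simp [Finset.card_finsuppAntidiag_nat_eq_choose]
  rw [add_comm 2 k]
  exact (Nat.choose_symm_add)

/-! ### Frames: an equation of a line together with a vector transverse to it -/

/-- A line equation `a·x + b·y + c = 0` with a vector `(u, v)` such that `a·u + b·v = 1`. -/
structure Frame (K : Type*) [Field K] where
  /-- The coefficient of `x`. -/
  a : K
  /-- The coefficient of `y`. -/
  b : K
  /-- The constant coefficient. -/
  c : K
  /-- The first coordinate of the transverse vector. -/
  u : K
  /-- The second coordinate of the transverse vector. -/
  v : K
  transverse : a * u + b * v = 1

namespace Frame

/-- The affine line of a frame. -/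
def line (F : Frame K) : Set (K × K) := {p | F.a * p.1 + F.b * p.2 + F.c = 0}

/-- The homogenized equation of the line of a frame. -/
noncomputable def form (F : Frame K) : MvPolynomial (Fin 3) K := lin3 F.a F.b F.c

/-- The component of a derivation transverse to the line: its value on the equation. -/
noncomputable def nor (F : Frame K) :
    MvPolynomial (Fin 3) K × MvPolynomial (Fin 3) K →ₗ[MvPolynomial (Fin 3) K]
      MvPolynomial (Fin 3) K :=
  (C F.a : MvPolynomial (Fin 3) K) • LinearMap.fst _ _ _ +
    (C F.b : MvPolynomial (Fin 3) K) • LinearMap.snd _ _ _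

/-- The component of a derivation along the line. -/
noncomputable def tan (F : Frame K) :
    MvPolynomial (Fin 3) K × MvPolynomial (Fin 3) K →ₗ[MvPolynomial (Fin 3) K]
      MvPolynomial (Fin 3) K :=
  (C F.u : MvPolynomial (Fin 3) K) • LinearMap.snd _ _ _ -
    (C F.v : MvPolynomial (Fin 3) K) • LinearMap.fst _ _ _

/-- The parametrization of the line of a frame. -/
def pt (F : Frame K) (t : K) : K × K := (-(F.c * F.u) - F.b * t, -(F.c * F.v) + F.a * t)

/-- Dehomogenized restriction of polynomials to the line of a frame. -/
noncomputable def res (F : Frame K) : MvPolynomial (Fin 3) K →ₐ[K] Polynomial K :=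
  aeval ![Polynomial.C (-(F.c * F.u)) - Polynomial.C F.b * Polynomial.X,
    Polynomial.C (-(F.c * F.v)) + Polynomial.C F.a * Polynomial.X, 1]

/-- The homogeneous coordinate on the line of a frame. -/
noncomputable def coord (F : Frame K) : MvPolynomial (Fin 3) K := C F.u * X 1 - C F.v * X 0

variable (F : Frame K)

theorem ab_ne : (F.a, F.b) ≠ (0, 0) := by
  intro h
  have h1 := F.transverse
  simp only [Prod.mk.injEq] at h
  simp [h.1, h.2] at h1

theorem C_transverse :
    (C F.a * C F.u + C F.b * C F.v : MvPolynomial (Fin 3) K) = 1 := by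
  rw [← C_mul, ← C_mul, ← C_add, F.transverse, C_1]

theorem nor_apply (θ : MvPolynomial (Fin 3) K × MvPolynomial (Fin 3) K) :
    F.nor θ = C F.a * θ.1 + C F.b * θ.2 := by simp [nor]

theorem tan_apply (θ : MvPolynomial (Fin 3) K × MvPolynomial (Fin 3) K) :
    F.tan θ = C F.u * θ.2 - C F.v * θ.1 := by simp [tan]

theorem fst_eq (θ : MvPolynomial (Fin 3) K × MvPolynomial (Fin 3) K) :
    θ.1 = C F.u * F.nor θ - C F.b * F.tan θ := by
  rw [nor_apply, tan_apply]
  linear_combination (-θ.1) * F.C_transverse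

theorem snd_eq (θ : MvPolynomial (Fin 3) K × MvPolynomial (Fin 3) K) :
    θ.2 = C F.v * F.nor θ + C F.a * F.tan θ := by
  rw [nor_apply, tan_apply]
  linear_combination (-θ.2) * F.C_transverse

theorem det_eq (θ φ : MvPolynomial (Fin 3) K × MvPolynomial (Fin 3) K) :
    θ.1 * φ.2 - θ.2 * φ.1 = F.nor θ * F.tan φ - F.tan θ * F.nor φ := by
  simp only [nor_apply, tan_apply]
  linear_combination (-(θ.1 * φ.2 - θ.2 * φ.1)) * F.C_transverse

theorem isHomogeneous_form : F.form.IsHomogeneous 1 :=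
  ((isHomogeneous_C_mul_X _ _).add (isHomogeneous_C_mul_X _ _)).add (isHomogeneous_C_mul_X _ _)

theorem isHomogeneous_coord : F.coord.IsHomogeneous 1 :=
  (isHomogeneous_C_mul_X _ _).sub (isHomogeneous_C_mul_X _ _)

theorem res_C (r : K) : F.res (C r) = Polynomial.C r := by
  simp [res, Polynomial.algebraMap_eq]

theorem res_X_zero :
    F.res (X 0) = Polynomial.C (-(F.c * F.u)) - Polynomial.C F.b * Polynomial.X := by simp [res]

theorem res_X_one :
    F.res (X 1) = Polynomial.C (-(F.c * F.v)) + Polynomial.C F.a * Polynomial.X := by simp [res]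

theorem res_X_two : F.res (X 2) = 1 := by simp [res]

theorem res_lin3 (a b c : K) : F.res (lin3 a b c) =
    Polynomial.C (a * (F.pt 0).1 + b * (F.pt 0).2 + c) +
      Polynomial.C (F.a * b - F.b * a) * Polynomial.X := by
  simp only [lin3, map_add, map_mul, res_C, res_X_zero, res_X_one, res_X_two, pt, map_neg, map_sub]
  simp
  ring

theorem eval_res_lin3 (a b c t : K) :
    (F.res (lin3 a b c)).eval t = a * (F.pt t).1 + b * (F.pt t).2 + c := by
  rw [res_lin3]
  simp [pt]
  ring

theorem pt_mem (t : K) : F.pt t ∈ F.line := by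
  change F.a * (F.pt t).1 + F.b * (F.pt t).2 + F.c = 0
  simp only [pt]
  linear_combination (-F.c) * F.transverse

theorem exists_pt {p : K × K} (hp : p ∈ F.line) : ∃ t, F.pt t = p := by
  change F.a * p.1 + F.b * p.2 + F.c = 0 at hp
  refine ⟨F.u * p.2 - F.v * p.1, Prod.ext ?_ ?_⟩ <;> simp only [pt]
  · linear_combination p.1 * F.transverse - F.u * hp
  · linear_combination p.2 * F.transverse - F.v * hp

theorem res_form : F.res F.form = 0 := by
  have h := F.pt_mem 0
  change F.a * (F.pt 0).1 + F.b * (F.pt 0).2 + F.c = 0 at h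
  rw [form, res_lin3, h]
  simp [mul_comm]

theorem res_coord : F.res F.coord = Polynomial.X := by
  have h : Polynomial.C F.a * Polynomial.C F.u + Polynomial.C F.b * Polynomial.C F.v =
    (1 : Polynomial K) := by
    rw [← Polynomial.C_mul, ← Polynomial.C_mul, ← Polynomial.C_add, F.transverse, Polynomial.C_1]
  simp only [coord, map_sub, map_mul, res_C, res_X_zero, res_X_one, map_neg]
  linear_combination Polynomial.X * h

/-- The projection onto the line of a frame along its transverse vector. -/
noncomputable def proj : MvPolynomial (Fin 3) K →ₐ[K] MvPolynomial (Fin 3) K :=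
  aeval ![X 0 - C F.u * F.form, X 1 - C F.v * F.form, X 2]

theorem form_dvd_sub_proj (f : MvPolynomial (Fin 3) K) : F.form ∣ f - F.proj f := by
  rw [← Ideal.mem_span_singleton, ← Ideal.Quotient.eq]
  have : (Ideal.Quotient.mkₐ K (Ideal.span {F.form})) =
      (Ideal.Quotient.mkₐ K (Ideal.span {F.form})).comp F.proj := by
    apply MvPolynomial.algHom_ext
    intro i
    rw [AlgHom.comp_apply, Ideal.Quotient.mkₐ_eq_mk, Ideal.Quotient.eq, Ideal.mem_span_singleton]
    fin_cases i <;> simp [proj]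
  exact congrArg (fun g => g f) this

theorem proj_form : F.proj F.form = 0 := by
  have : F.proj F.form = C F.a * (X 0 - C F.u * F.form) + C F.b * (X 1 - C F.v * F.form) +
      C F.c * X 2 := by
    conv_lhs => rw [form, lin3]
    simp [proj, algebraMap_eq]
  have hform : F.form = C F.a * X 0 + C F.b * X 1 + C F.c * X 2 := rfl
  rw [this]
  linear_combination (-F.form) * F.C_transverse - hform

theorem form_dvd_iff_proj (f : MvPolynomial (Fin 3) K) : F.form ∣ f ↔ F.proj f = 0 := by
  constructor
  · rintro ⟨g, rfl⟩
    rw [map_mul, proj_form, zero_mul]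
  · intro h
    simpa [h] using F.form_dvd_sub_proj f

theorem form_ne_zero : F.form ≠ 0 := by
  intro h
  have h0 : coeff (Finsupp.single 0 1) F.form = 0 := by rw [h, coeff_zero]
  have h1 : coeff (Finsupp.single 1 1) F.form = 0 := by rw [h, coeff_zero]
  simp [form, lin3, coeff_C_mul, coeff_X, Finsupp.single_left_inj] at h0 h1
  exact F.ab_ne (by rw [h0, h1])

theorem prime_form : Prime F.form := by
  refine ⟨F.form_ne_zero, fun hu => ?_, fun f g hfg => ?_⟩
  · have := hu.map F.proj
    rw [proj_form] at this
    exact not_isUnit_zero this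
  · simpa [form_dvd_iff_proj] using hfg

theorem proj_eq_zero_of_res_eq_zero {f : MvPolynomial (Fin 3) K} {k : ℕ}
    (hf : f.IsHomogeneous k) (h : F.res f = 0) : F.proj f = 0 := by
  let ι := algebraMap (MvPolynomial (Fin 3) K) (FractionRing (MvPolynomial (Fin 3) K))
  have hinj : Function.Injective ι := IsFractionRing.injective _ _
  have hz : ι (X 2) ≠ 0 := by
    rw [Ne, map_eq_zero_iff ι hinj]
    exact X_ne_zero 2
  apply hinj
  rw [map_zero]
  let x : Fin 3 → FractionRing (MvPolynomial (Fin 3) K) := fun i =>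
    Polynomial.aeval (ι F.coord / ι (X 2)) (F.res (X i))
  have h1 : ι (F.proj f) = aeval (fun i => ι (X 2) * x i) f := by
    have : (Algebra.ofId (MvPolynomial (Fin 3) K) (FractionRing (MvPolynomial (Fin 3) K))
      |>.restrictScalars K).comp F.proj = aeval (fun i => ι (X 2) * x i) := by
      apply MvPolynomial.algHom_ext
      intro i
      rw [AlgHom.comp_apply, aeval_X]
      have hC (r : K) : (algebraMap K (FractionRing (MvPolynomial (Fin 3) K))) r = ι (C r) := by
        rw [← MvPolynomial.algebraMap_eq, ← IsScalarTower.algebraMap_apply]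
      have hT : ι (C F.a) * ι (C F.u) + ι (C F.b) * ι (C F.v) = 1 := by
        simpa only [map_mul, map_add, map_one] using congrArg ι F.C_transverse
      change ι _ = _
      fin_cases i
      · simp [x, res_X_zero, proj, coord, form, lin3, hC]
        field_simp
        linear_combination (-ι (X 0)) * hT
      · simp [x, res_X_one, proj, coord, form, lin3, hC]
        field_simp
        linear_combination (-ι (X 1)) * hT
      · simp [x, res_X_two, proj]
    exact congrArg (fun g => g f) this
  rw [h1, aeval_mul_left_of_isHomogeneous hf]
  have h2 : aeval x f = Polynomial.aeval (ι F.coord / ι (X 2)) (F.res f) := by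
    have : aeval x = (Polynomial.aeval (ι F.coord / ι (X 2))).comp F.res := by
      apply MvPolynomial.algHom_ext
      intro i
      simp [x]
    exact congrArg (fun g => g f) this
  rw [h2, h, map_zero, mul_zero]

theorem form_dvd_iff_res {f : MvPolynomial (Fin 3) K} {k : ℕ} (hf : f.IsHomogeneous k) :
    F.form ∣ f ↔ F.res f = 0 := by
  refine ⟨?_, fun h => (F.form_dvd_iff_proj f).mpr (F.proj_eq_zero_of_res_eq_zero hf h)⟩
  rintro ⟨g, rfl⟩
  rw [map_mul, res_form, zero_mul]

theorem natDegree_res_le (f : MvPolynomial (Fin 3) K) : (F.res f).natDegree ≤ f.totalDegree := by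
  have := aeval_natDegree_le (n := 1) f le_rfl
    ![Polynomial.C (-(F.c * F.u)) - Polynomial.C F.b * Polynomial.X,
    Polynomial.C (-(F.c * F.v)) + Polynomial.C F.a * Polynomial.X, 1] (by
      intro i
      fin_cases i
      · simp only [sub_eq_add_neg, ← Polynomial.C_neg, ← neg_mul]
        rw [add_comm]
        exact Polynomial.natDegree_linear_le
      · simp only [Fin.mk_one, Matrix.cons_val_one]
        rw [add_comm]
        exact Polynomial.natDegree_linear_le
      · simp)
  simpa [res] using this

/-- Every univariate polynomial of degree at most `k` is the restriction of a form of
degree `k`. -/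
theorem exists_res_eq {g : Polynomial K} {k : ℕ} (hg : g.natDegree ≤ k) :
    ∃ f : MvPolynomial (Fin 3) K, f.IsHomogeneous k ∧ F.res f = g := by
  refine ⟨∑ i ∈ Finset.range (k + 1), C (g.coeff i) * (F.coord ^ i * X 2 ^ (k - i)), ?_, ?_⟩
  · refine IsHomogeneous.sum _ _ _ fun i hi => IsHomogeneous.C_mul ?_ _
    have hi' : i + (k - i) = k := by
      have := Finset.mem_range.mp hi
      omega
    conv => arg 2; rw [← hi']
    simpa using (F.isHomogeneous_coord.pow i).mul (isHomogeneous_X_pow (R := K) 2 (k - i))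
  · simp only [map_sum, map_mul, map_pow, res_C, res_coord, res_X_two, one_pow, mul_one]
    exact (g.as_sum_range_C_mul_X_pow' (by omega)).symm

end Frame

/-! ### Logarithmic derivations of an arrangement -/

theorem Frame.exists_line_eq {L : Set (K × K)} (hL : IsAffineLine L) :
    ∃ F : Frame K, F.line = L := by
  obtain ⟨a, b, c, hab, rfl⟩ := hL
  by_cases ha : a = 0
  · have hb : b ≠ 0 := fun hb => hab (by rw [ha, hb])
    exact ⟨⟨a, b, c, 0, b⁻¹, by simp [hb]⟩, rfl⟩
  · exact ⟨⟨a, b, c, a⁻¹, 0, by simp [ha]⟩, rfl⟩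

open Classical in
/-- A frame of an affine line (a junk value if `L` is not an affine line). -/
noncomputable def frame (L : Set (K × K)) : Frame K :=
  if h : ∃ F : Frame K, F.line = L then h.choose else ⟨1, 0, 0, 1, 0, by simp⟩

theorem line_frame {L : Set (K × K)} (hL : IsAffineLine L) : (frame L).line = L := by
  have h := Frame.exists_line_eq hL
  rw [frame, dif_pos h]
  exact h.choose_spec

theorem Frame.exists_smul_of_line_subset (F : Frame K) {a b c : K} (hab : (a, b) ≠ (0, 0))
    (h : F.line ⊆ {p | a * p.1 + b * p.2 + c = 0}) :
    ∃ r, r ≠ 0 ∧ a = r * F.a ∧ b = r * F.b ∧ c = r * F.c := by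
  have h0 : a * (F.pt 0).1 + b * (F.pt 0).2 + c = 0 := h (F.pt_mem 0)
  have h1 : a * (F.pt 1).1 + b * (F.pt 1).2 + c = 0 := h (F.pt_mem 1)
  simp only [Frame.pt] at h0 h1
  have ha : a = (a * F.u + b * F.v) * F.a := by
    linear_combination (-a) * F.transverse + F.v * (h0 - h1)
  have hb : b = (a * F.u + b * F.v) * F.b := by
    linear_combination (-b) * F.transverse - F.u * (h0 - h1)
  refine ⟨a * F.u + b * F.v, fun hr => hab ?_, ha, hb, by linear_combination h0⟩
  rw [ha.trans (by rw [hr, zero_mul]), hb.trans (by rw [hr, zero_mul])]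

theorem eq_of_subset {L M : Set (K × K)} (hL : IsAffineLine L) (hM : IsAffineLine M)
    (h : L ⊆ M) : L = M := by
  rw [← line_frame hL, ← line_frame hM] at *
  obtain ⟨r, hr, ha, hb, hc⟩ := (frame L).exists_smul_of_line_subset (frame M).ab_ne h
  ext p
  simp only [Frame.line, Set.mem_ofPred_eq, ha, hb, hc]
  rw [show r * (frame L).a * p.1 + r * (frame L).b * p.2 + r * (frame L).c =
    r * ((frame L).a * p.1 + (frame L).b * p.2 + (frame L).c) by ring]
  simp [hr]

/-- The derivation `θ.1 ∂ₓ + θ.2 ∂_y` is logarithmic along all lines of `A`. -/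
def IsLog (A : Finset (Set (K × K))) (θ : MvPolynomial (Fin 3) K × MvPolynomial (Fin 3) K) :
    Prop := ∀ L ∈ A, (frame L).form ∣ (frame L).nor θ

theorem applyDer3_lin3 (θ : Fin 3 → MvPolynomial (Fin 3) K) (a b c : K) :
    applyDer3 θ (lin3 a b c) = C a * θ 0 + C b * θ 1 + C c * θ 2 := by
  simp [applyDer3, lin3, Fin.sum_univ_three, pderiv_X, Pi.single_apply]
  ring

theorem inDCone_iff {A : Finset (Set (K × K))} (hA : IsLineArr A)
    (θ : Fin 3 → MvPolynomial (Fin 3) K) :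
    InDCone A θ ↔ ∃ g, θ 2 = g * X 2 ∧ IsLog A (θ 0 - g * X 0, θ 1 - g * X 1) := by
  have hX : applyDer3 θ (X 2) = θ 2 := by
    simp [applyDer3, pderiv_X, Pi.single_apply]
  have key {g : MvPolynomial (Fin 3) K} (hg : θ 2 = g * X 2) (a b c : K) :
      applyDer3 θ (lin3 a b c) =
        (C a * (θ 0 - g * X 0) + C b * (θ 1 - g * X 1)) + g * lin3 a b c := by
    rw [applyDer3_lin3, hg, lin3]
    ring
  unfold InDCone
  rw [hX]
  constructor
  · rintro ⟨h, g, hg⟩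
    refine ⟨g, hg, fun L hL => ?_⟩
    obtain ⟨q, hq⟩ := h L hL _ _ _ (frame L).ab_ne (line_frame (hA L hL)).symm
    rw [key hg] at hq
    rw [Frame.nor_apply]
    exact ⟨q - g, by rw [Frame.form]; linear_combination hq⟩
  · rintro ⟨g, hg, h⟩
    refine ⟨fun L hL a b c hab hLe => ?_, g, hg⟩
    obtain ⟨r, hr, rfl, rfl, rfl⟩ := (frame L).exists_smul_of_line_subset hab
      (by rw [line_frame (hA L hL)]; exact hLe.le)
    obtain ⟨q, hq⟩ := h L hL
    refine ⟨q + g, ?_⟩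
    rw [key hg]
    rw [Frame.nor_apply, Frame.form, lin3] at hq
    simp only [lin3, C_mul] at hq ⊢
    linear_combination C r * hq

/-- The coefficient determinant of two derivations. -/
noncomputable def wedge (θ φ : MvPolynomial (Fin 3) K × MvPolynomial (Fin 3) K) :
    MvPolynomial (Fin 3) K := θ.1 * φ.2 - θ.2 * φ.1

theorem Frame.form_dvd_wedge (F : Frame K)
    {θ φ : MvPolynomial (Fin 3) K × MvPolynomial (Fin 3) K}
    (hθ : F.form ∣ F.nor θ) (hφ : F.form ∣ F.nor φ) : F.form ∣ wedge θ φ := by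
  rw [wedge, F.det_eq]
  exact dvd_sub (hθ.mul_right _) (hφ.mul_left _)

/-- The product of the homogenized equations of the lines of `A`. -/
noncomputable def defPoly (A : Finset (Set (K × K))) : MvPolynomial (Fin 3) K :=
  ∏ L ∈ A, (frame L).form

theorem defPoly_ne_zero (A : Finset (Set (K × K))) : defPoly A ≠ 0 :=
  Finset.prod_ne_zero_iff.mpr fun L _ => (frame L).form_ne_zero

theorem isHomogeneous_defPoly (A : Finset (Set (K × K))) : (defPoly A).IsHomogeneous A.card := by
  have := IsHomogeneous.prod A (fun L => (frame L).form) (fun _ => 1)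
    fun L _ => (frame L).isHomogeneous_form
  simpa [defPoly] using this

theorem not_form_dvd_form {L M : Set (K × K)} (hL : IsAffineLine L) (hM : IsAffineLine M)
    (h : L ≠ M) : ¬ (frame L).form ∣ (frame M).form := by
  intro hd
  refine h (eq_of_subset hL hM fun p hp => ?_)
  rw [← line_frame hL] at hp
  rw [← line_frame hM]
  obtain ⟨t, rfl⟩ := (frame L).exists_pt hp
  have : (frame L).res (frame L).form ∣ (frame L).res (frame M).form := map_dvd _ hd
  rw [Frame.res_form, zero_dvd_iff] at this
  have h2 := (frame L).eval_res_lin3 (frame M).a (frame M).b (frame M).c t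
  rw [← Frame.form, this, Polynomial.eval_zero] at h2
  exact h2.symm

theorem defPoly_dvd {A : Finset (Set (K × K))} (hA : IsLineArr A) {f : MvPolynomial (Fin 3) K}
    (h : ∀ L ∈ A, (frame L).form ∣ f) : defPoly A ∣ f := by
  refine Finset.prod_dvd_of_isRelPrime (fun L hL M hM hLM => ?_) h
  exact ((frame L).prime_form.irreducible.isRelPrime_iff_not_dvd).mpr
    (not_form_dvd_form (hA L hL) (hA M hM) hLM)

/-- Freeness in terms of the derivations annihilating `z`. -/
theorem isFreeExp_iff {A : Finset (Set (K × K))} (hA : IsLineArr A) (d₁ d₂ : ℕ) :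
    IsFreeExp A d₁ d₂ ↔ ∃ θ₁ θ₂ : MvPolynomial (Fin 3) K × MvPolynomial (Fin 3) K,
      IsLog A θ₁ ∧ IsLog A θ₂ ∧ (θ₁.1.IsHomogeneous d₁ ∧ θ₁.2.IsHomogeneous d₁) ∧
      (θ₂.1.IsHomogeneous d₂ ∧ θ₂.2.IsHomogeneous d₂) ∧
      ∀ θ, IsLog A θ → ∃! c : MvPolynomial (Fin 3) K × MvPolynomial (Fin 3) K,
        θ = c.1 • θ₁ + c.2 • θ₂ := by
  have hX2 : (X 2 : MvPolynomial (Fin 3) K) ≠ 0 := X_ne_zero 2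
  constructor
  · rintro ⟨θ₁, θ₂, h₁, h₂, hd₁, hd₂, H⟩
    have hom {θ : Fin 3 → MvPolynomial (Fin 3) K} {d : ℕ} (hd : HomogDer3 θ d)
        {g : MvPolynomial (Fin 3) K} (hg : θ 2 = g * X 2) :
        (θ 0 - g * X 0).IsHomogeneous d ∧ (θ 1 - g * X 1).IsHomogeneous d := by
      have h2 : (X 2 * g).IsHomogeneous d := by rw [mul_comm, ← hg]; exact hd 2
      rcases d with _ | d
      · have : X 2 * g = 0 := by
          rw [← homogeneousComponent_eq_self h2,
            homogeneousComponent_mul_of_lt (isHomogeneous_X K 2) g one_pos]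
        have hg0 : g = 0 := (mul_eq_zero.mp this).resolve_left hX2
        simpa [hg0] using ⟨hd 0, hd 1⟩
      · rw [add_comm] at h2
        have hg' := IsHomogeneous.of_mul_left (isHomogeneous_X K 2) hX2 h2
        exact ⟨(hd 0).sub (hg'.mul (isHomogeneous_X K 0)),
          (hd 1).sub (hg'.mul (isHomogeneous_X K 1))⟩
    obtain ⟨g₁, hg₁, hl₁⟩ := (inDCone_iff hA θ₁).mp h₁
    obtain ⟨g₂, hg₂, hl₂⟩ := (inDCone_iff hA θ₂).mp h₂
    refine ⟨_, _, hl₁, hl₂, hom hd₁ hg₁, hom hd₂ hg₂, fun θ hθ => ?_⟩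
    obtain ⟨c, hc, huniq⟩ := H ![θ.1, θ.2, 0]
      ((inDCone_iff hA _).mpr ⟨0, by simp, by simpa using hθ⟩)
    have c0 := congrFun hc 0
    have c1 := congrFun hc 1
    have c2 := congrFun hc 2
    simp only [Matrix.cons_val_zero, Matrix.cons_val_one, Matrix.cons_val, hg₁, hg₂] at c0 c1 c2
    have hc2 : c.1 + c.2.1 * g₁ + c.2.2 * g₂ = 0 := by
      refine (mul_eq_zero.mp (?_ : (c.1 + c.2.1 * g₁ + c.2.2 * g₂) * X 2 = 0)).resolve_right hX2
      linear_combination -c2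
    refine ⟨c.2, Prod.ext ?_ ?_, fun e he => ?_⟩
    · simp only [Prod.fst_add, Prod.smul_fst, smul_eq_mul]
      linear_combination c0 + X 0 * hc2
    · simp only [Prod.snd_add, Prod.smul_snd, smul_eq_mul]
      linear_combination c1 + X 1 * hc2
    · have e0 := congrArg Prod.fst he
      have e1 := congrArg Prod.snd he
      simp only [Prod.fst_add, Prod.smul_fst, Prod.snd_add, Prod.smul_snd, smul_eq_mul] at e0 e1
      rw [← huniq (-(e.1 * g₁) - e.2 * g₂, e) ?_]
      funext j
      fin_cases j
      · simp only [Fin.zero_eta, Matrix.cons_val_zero]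
        linear_combination e0
      · simp only [Fin.mk_one, Matrix.cons_val_one, Matrix.cons_val_zero]
        linear_combination e1
      · simp only [Fin.reduceFinMk, Matrix.cons_val, hg₁, hg₂]
        ring
  · rintro ⟨θ₁, θ₂, h₁, h₂, hd₁, hd₂, H⟩
    have hom {θ : MvPolynomial (Fin 3) K × MvPolynomial (Fin 3) K} {d : ℕ}
        (hd : θ.1.IsHomogeneous d ∧ θ.2.IsHomogeneous d) : HomogDer3 ![θ.1, θ.2, 0] d := by
      intro i
      fin_cases i
      · exact hd.1
      · exact hd.2
      · exact isHomogeneous_zero _ _ d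
    refine ⟨![θ₁.1, θ₁.2, 0], ![θ₂.1, θ₂.2, 0],
      (inDCone_iff hA _).mpr ⟨0, by simp, by simpa using h₁⟩,
      (inDCone_iff hA _).mpr ⟨0, by simp, by simpa using h₂⟩, hom hd₁, hom hd₂, fun θ hθ => ?_⟩
    obtain ⟨g, hg, hl⟩ := (inDCone_iff hA θ).mp hθ
    obtain ⟨c, hc, huniq⟩ := H _ hl
    have c0 := congrArg Prod.fst hc
    have c1 := congrArg Prod.snd hc
    simp only [Prod.fst_add, Prod.smul_fst, Prod.snd_add, Prod.smul_snd, smul_eq_mul] at c0 c1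
    refine ⟨(g, c), ?_, ?_⟩
    · funext j
      fin_cases j
      · simp only [Fin.zero_eta, Matrix.cons_val_zero]
        linear_combination c0
      · simp only [Fin.mk_one, Matrix.cons_val_one, Matrix.cons_val_zero]
        linear_combination c1
      · simp only [Fin.reduceFinMk, Matrix.cons_val, hg]
        ring
    · rintro ⟨e0, e⟩ he
      have k0 := congrFun he 0
      have k1 := congrFun he 1
      have k2 := congrFun he 2
      simp only [Matrix.cons_val_zero, Matrix.cons_val_one, Matrix.cons_val, hg] at k0 k1 k2
      have : e0 = g := mul_right_cancel₀ hX2 (by linear_combination -k2)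
      subst this
      refine Prod.ext rfl (huniq e (Prod.ext ?_ ?_))
      · simp only [Prod.fst_add, Prod.smul_fst, smul_eq_mul]
        linear_combination k0
      · simp only [Prod.snd_add, Prod.smul_snd, smul_eq_mul]
        linear_combination k1

/-- Saito's criterion. -/
theorem isFreeExp_of_wedge_ne_zero {A : Finset (Set (K × K))} (hA : IsLineArr A)
    {θ φ : MvPolynomial (Fin 3) K × MvPolynomial (Fin 3) K} {d₁ d₂ : ℕ}
    (hθ : IsLog A θ) (hφ : IsLog A φ)
    (hd₁ : θ.1.IsHomogeneous d₁ ∧ θ.2.IsHomogeneous d₁)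
    (hd₂ : φ.1.IsHomogeneous d₂ ∧ φ.2.IsHomogeneous d₂)
    (hd : d₁ + d₂ = A.card) (hw : wedge θ φ ≠ 0) : IsFreeExp A d₁ d₂ := by
  rw [isFreeExp_iff hA]
  have hQ := defPoly_ne_zero A
  have dvd {θ φ} (hθ : IsLog A θ) (hφ : IsLog A φ) : defPoly A ∣ wedge θ φ :=
    defPoly_dvd hA fun L hL => (frame L).form_dvd_wedge (hθ L hL) (hφ L hL)
  obtain ⟨q, hq⟩ := dvd hθ hφ
  have hwh : (wedge θ φ).IsHomogeneous (A.card + 0) := by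
    rw [add_zero, ← hd]
    exact (hd₁.1.mul hd₂.2).sub (hd₁.2.mul hd₂.1)
  rw [hq] at hwh
  have hq0 := IsHomogeneous.of_mul_left (isHomogeneous_defPoly A) hQ hwh
  obtain ⟨r, rfl⟩ : ∃ r, q = C r := by
    refine ⟨coeff 0 q, ?_⟩
    rw [← homogeneousComponent_zero, homogeneousComponent_eq_self hq0]
  have hr : r ≠ 0 := by
    rintro rfl
    exact hw (by rw [hq, C_0, mul_zero])
  have hrr : (C r * C r⁻¹ : MvPolynomial (Fin 3) K) = 1 := by
    rw [← C_mul, mul_inv_cancel₀ hr, C_1]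
  refine ⟨θ, φ, hθ, hφ, hd₁, hd₂, fun ω hω => ?_⟩
  obtain ⟨s, hs⟩ := dvd hω hφ
  obtain ⟨t, ht⟩ := dvd hθ hω
  have hqr : wedge θ φ ≠ 0 := hw
  unfold wedge at hq hs ht hqr
  refine ⟨(C r⁻¹ * s, C r⁻¹ * t), Prod.ext ?_ ?_, ?_⟩
  · apply mul_left_cancel₀ hQ
    simp only [Prod.fst_add, Prod.smul_fst, smul_eq_mul]
    linear_combination (-(defPoly A) * ω.1) * hrr - C r⁻¹ * ω.1 * hq + C r⁻¹ * θ.1 * hs +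
      C r⁻¹ * φ.1 * ht
  · apply mul_left_cancel₀ hQ
    simp only [Prod.snd_add, Prod.smul_snd, smul_eq_mul]
    linear_combination (-(defPoly A) * ω.2) * hrr - C r⁻¹ * ω.2 * hq + C r⁻¹ * θ.2 * hs +
      C r⁻¹ * φ.2 * ht
  · rintro ⟨e, f⟩ rfl
    simp only [Prod.fst_add, Prod.smul_fst, Prod.snd_add, Prod.smul_snd, smul_eq_mul] at hs ht
    refine Prod.ext ?_ ?_
    · apply mul_left_cancel₀ hQ
      simp only
      linear_combination (-(defPoly A) * e) * hrr - C r⁻¹ * e * hq + C r⁻¹ * hs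
    · apply mul_left_cancel₀ hQ
      simp only
      linear_combination (-(defPoly A) * f) * hrr - C r⁻¹ * f * hq + C r⁻¹ * ht

/-! ### Linear algebra -/

theorem finrank_eq_add_of_map_eq {V W : Type*} [AddCommGroup V] [Module K V] [AddCommGroup W]
    [Module K W] (f : V →ₗ[K] W) {M M' : Submodule K V} [FiniteDimensional K M]
    (hM : ∀ x, x ∈ M' ↔ x ∈ M ∧ f x = 0) :
    Module.finrank K M = Module.finrank K (M.map f) + Module.finrank K M' := by
  rw [← LinearMap.finrank_range_add_finrank_ker (f.domRestrict M), LinearMap.range_domRestrict]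
  congr 1
  have : M' = (LinearMap.ker (f.domRestrict M)).map M.subtype := by
    ext x
    rw [hM]
    simp [and_comm]
  rw [this]
  exact (LinearEquiv.finrank_eq (Submodule.equivMapOfInjective _ M.injective_subtype _))

/-- The multiples of `P` of degree at most `k`. -/
noncomputable def mulDegreeLE (P : Polynomial K) (k : ℕ) : Submodule K (Polynomial K) :=
  (Polynomial.degreeLT K (k + 1 - P.natDegree)).map (LinearMap.mulLeft K P)

instance (P : Polynomial K) (k : ℕ) : FiniteDimensional K (mulDegreeLE P k) := by
  unfold mulDegreeLE
  infer_instance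

theorem finrank_mulDegreeLE {P : Polynomial K} (hP : P ≠ 0) (k : ℕ) :
    Module.finrank K (mulDegreeLE P k) = k + 1 - P.natDegree := by
  rw [mulDegreeLE, ← LinearEquiv.finrank_eq (Submodule.equivMapOfInjective _
    (fun p q h => mul_left_cancel₀ hP h) _), (Polynomial.degreeLTEquiv K _).finrank_eq]
  simp

theorem mem_mulDegreeLE {P : Polynomial K} (hP : P ≠ 0) {k : ℕ} {p : Polynomial K}
    (hp : p.natDegree ≤ k) (hd : P ∣ p) : p ∈ mulDegreeLE P k := by
  obtain ⟨q, rfl⟩ := hd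
  refine ⟨q, ?_, rfl⟩
  rw [SetLike.mem_coe, Polynomial.mem_degreeLT]
  rcases eq_or_ne q 0 with rfl | hq
  · rw [Polynomial.degree_zero]
    exact WithBot.bot_lt_coe _
  · rw [Polynomial.natDegree_mul hP hq] at hp
    rw [Polynomial.degree_eq_natDegree hq]
    exact_mod_cast (by omega : q.natDegree < k + 1 - P.natDegree)

/-! ### Graded pieces of the module of logarithmic derivations -/

/-- The logarithmic derivations of `A` annihilating `z` which are homogeneous of degree `k`. -/
noncomputable def logDer (A : Finset (Set (K × K))) (k : ℕ) :
    Submodule K (MvPolynomial (Fin 3) K × MvPolynomial (Fin 3) K) where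
  carrier := {θ | IsLog A θ ∧ θ.1.IsHomogeneous k ∧ θ.2.IsHomogeneous k}
  add_mem' := fun h₁ h₂ => ⟨fun L hL => by rw [map_add]; exact dvd_add (h₁.1 L hL) (h₂.1 L hL),
    h₁.2.1.add h₂.2.1, h₁.2.2.add h₂.2.2⟩
  zero_mem' := ⟨fun L _ => by simp, isHomogeneous_zero _ _ _, isHomogeneous_zero _ _ _⟩
  smul_mem' := fun r θ h => by
    refine ⟨fun L hL => ?_, ?_, ?_⟩
    · rw [← algebraMap_smul (MvPolynomial (Fin 3) K) r θ, map_smul, smul_eq_mul]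
      exact (h.1 L hL).mul_left _
    · rw [Prod.smul_fst, smul_eq_C_mul]
      exact h.2.1.C_mul _
    · rw [Prod.smul_snd, smul_eq_C_mul]
      exact h.2.2.C_mul _

instance (A : Finset (Set (K × K))) (k : ℕ) : FiniteDimensional K (logDer A k) := by
  have : FiniteDimensional K
      ((homogeneousSubmodule (Fin 3) K k).prod (homogeneousSubmodule (Fin 3) K k)) :=
    Module.Finite.iff_fg.mpr (Submodule.FG.prod (Module.Finite.iff_fg.mp inferInstance)
      (Module.Finite.iff_fg.mp inferInstance))
  exact Submodule.finiteDimensional_of_le (S₂ := (homogeneousSubmodule (Fin 3) K k).prod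
    (homogeneousSubmodule (Fin 3) K k)) fun θ h => h.2

open Classical in
theorem isLog_insert {A : Finset (Set (K × K))} {H : Set (K × K)}
    {θ : MvPolynomial (Fin 3) K × MvPolynomial (Fin 3) K} :
    IsLog (insert H A) θ ↔ (frame H).form ∣ (frame H).nor θ ∧ IsLog A θ :=
  Finset.forall_mem_insert ..

theorem Frame.isHomogeneous_nor (F : Frame K)
    {θ : MvPolynomial (Fin 3) K × MvPolynomial (Fin 3) K} {k : ℕ}
    (h : θ.1.IsHomogeneous k ∧ θ.2.IsHomogeneous k) : (F.nor θ).IsHomogeneous k := by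
  rw [nor_apply]
  exact (h.1.C_mul _).add (h.2.C_mul _)

theorem Frame.isHomogeneous_tan (F : Frame K)
    {θ : MvPolynomial (Fin 3) K × MvPolynomial (Fin 3) K} {k : ℕ}
    (h : θ.1.IsHomogeneous k ∧ θ.2.IsHomogeneous k) : (F.tan θ).IsHomogeneous k := by
  rw [tan_apply]
  exact (h.2.C_mul _).sub (h.1.C_mul _)

theorem Frame.isAffineLine (F : Frame K) : IsAffineLine F.line :=
  ⟨F.a, F.b, F.c, F.ab_ne, rfl⟩

theorem Frame.res_form_ne_zero (F : Frame K) {L : Set (K × K)} (hL : IsAffineLine L)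
    (h : L ≠ F.line) : F.res (frame L).form ≠ 0 := by
  intro h0
  refine h (eq_of_subset F.isAffineLine hL fun p hp => ?_).symm
  rw [← line_frame hL]
  obtain ⟨t, rfl⟩ := F.exists_pt hp
  have h2 := F.eval_res_lin3 (frame L).a (frame L).b (frame L).c t
  rw [← Frame.form, h0, Polynomial.eval_zero] at h2
  exact h2.symm

/-- The determinant of the directions of two lines; it vanishes iff the lines are parallel. -/
def Frame.slope (F G : Frame K) : K := F.a * G.b - F.b * G.a

theorem Frame.eval_res_form (F : Frame K) {L : Set (K × K)} (hL : IsAffineLine L) (q : K) :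
    (F.res (frame L).form).eval q = 0 ↔ F.pt q ∈ L := by
  rw [Frame.form, eval_res_lin3]
  conv_rhs => rw [← line_frame hL]
  rfl

theorem Frame.res_form_eq (F G : Frame K) : F.res G.form =
    Polynomial.C ((F.res G.form).eval 0) + Polynomial.C (F.slope G) * Polynomial.X := by
  rw [form, res_lin3]
  simp [slope]

theorem Frame.res_form_eq_of_mem (F : Frame K) {L : Set (K × K)} (hL : IsAffineLine L) {q : K}
    (hq : F.pt q ∈ L) : F.res (frame L).form =
      Polynomial.C (F.slope (frame L)) * (Polynomial.X - Polynomial.C q) := by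
  have h := (F.eval_res_form hL q).mpr hq
  rw [F.res_form_eq] at h ⊢
  simp only [Polynomial.eval_add, Polynomial.eval_mul, Polynomial.eval_C, Polynomial.eval_X] at h
  rw [eq_neg_of_add_eq_zero_left h]
  simp only [Polynomial.C_neg, Polynomial.C_mul]
  ring

theorem Frame.slope_ne_zero_of_mem (F : Frame K) {L : Set (K × K)} (hL : IsAffineLine L)
    (h : L ≠ F.line) {q : K} (hq : F.pt q ∈ L) : F.slope (frame L) ≠ 0 := by
  intro h0
  apply F.res_form_ne_zero hL h
  rw [F.res_form_eq_of_mem hL hq, h0, Polynomial.C_0, zero_mul]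

theorem Frame.exists_pt_mem (F : Frame K) {L : Set (K × K)} (hL : IsAffineLine L)
    (h : F.slope (frame L) ≠ 0) : ∃ q, F.pt q ∈ L := by
  refine ⟨-(F.res (frame L).form).eval 0 / F.slope (frame L), ?_⟩
  rw [← F.eval_res_form hL, F.res_form_eq]
  simp
  field_simp
  ring

open Classical in
/-- The parameters of the points of the line of `F` lying on lines of `A`. -/
noncomputable def Frame.trace (F : Frame K) (A : Finset (Set (K × K))) : Finset K :=
  A.biUnion fun L => (F.res (frame L).form).roots.toFinset

/-- `F` is a frame of a line not belonging to the line arrangement `A`. -/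
structure Frame.Avoids (F : Frame K) (A : Finset (Set (K × K))) : Prop where
  isLineArr : IsLineArr A
  ne_line : ∀ L ∈ A, L ≠ F.line

open Classical in
/-- The number of lines of `A` through the point of the line of `F` with parameter `q`. -/
noncomputable def Frame.mult (F : Frame K) (A : Finset (Set (K × K))) (q : K) : ℕ :=
  (A.filter fun L => F.pt q ∈ L).card

open Classical in
/-- The lines of `A` which are parallel to the line of `F`. -/
noncomputable def Frame.par (F : Frame K) (A : Finset (Set (K × K))) : Finset (Set (K × K)) :=
  A.filter fun L => F.slope (frame L) = 0

theorem Frame.Avoids.mono {F : Frame K} {A B : Finset (Set (K × K))} (hF : F.Avoids A)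
    (hB : B ⊆ A) : F.Avoids B :=
  ⟨fun L hL => hF.1 L (hB hL), fun L hL => hF.2 L (hB hL)⟩

/-! ### The trace of an arrangement on a line -/

namespace Frame.Avoids

variable {F : Frame K} {A : Finset (Set (K × K))}

theorem mem_trace (hF : F.Avoids A) {q : K} : q ∈ F.trace A ↔ ∃ L ∈ A, F.pt q ∈ L := by
  classical
  simp only [Frame.trace, Finset.mem_biUnion, Multiset.mem_toFinset]
  refine exists_congr fun L => and_congr_right fun hL => ?_
  rw [Polynomial.mem_roots (F.res_form_ne_zero (hF.1 L hL) (hF.2 L hL)), Polynomial.IsRoot,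
    F.eval_res_form (hF.1 L hL)]

theorem existsUnique_pt_mem (hF : F.Avoids A) {L : Set (K × K)} (hL : L ∈ A)
    (h : F.slope (frame L) ≠ 0) : ∃ q ∈ F.trace A, F.pt q ∈ L ∧ ∀ r, F.pt r ∈ L → r = q := by
  obtain ⟨q, hq⟩ := F.exists_pt_mem (hF.1 L hL) h
  refine ⟨q, hF.mem_trace.mpr ⟨L, hL, hq⟩, hq, fun r hr => ?_⟩
  have h1 := (F.eval_res_form (hF.1 L hL) r).mpr hr
  rw [F.res_form_eq_of_mem (hF.1 L hL) hq] at h1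
  simpa [h, sub_eq_zero] using h1

theorem one_le_mult (hF : F.Avoids A) {q : K} (hq : q ∈ F.trace A) : 1 ≤ F.mult A q := by
  classical
  obtain ⟨L, hL, hqL⟩ := hF.mem_trace.mp hq
  exact Finset.card_pos.mpr ⟨L, Finset.mem_filter.mpr ⟨hL, hqL⟩⟩

theorem sum_mult_add_card_par (hF : F.Avoids A) :
    ∑ q ∈ F.trace A, F.mult A q + (F.par A).card = A.card := by
  classical
  rw [← Finset.card_filter_add_card_filter_not (s := A) (fun L => F.slope (frame L) ≠ 0)]
  congr 1
  · simp only [Frame.mult]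
    rw [← Finset.card_biUnion]
    · congr 1
      ext L
      simp only [Finset.mem_biUnion, Finset.mem_filter]
      constructor
      · rintro ⟨q, -, hL, hq⟩
        exact ⟨hL, F.slope_ne_zero_of_mem (hF.1 L hL) (hF.2 L hL) hq⟩
      · rintro ⟨hL, h⟩
        obtain ⟨q, hq, hqL, -⟩ := hF.existsUnique_pt_mem hL h
        exact ⟨q, hq, hL, hqL⟩
    · intro q _ r _ hqr
      rw [Function.onFun, Finset.disjoint_left]
      intro L hL hL'
      rw [Finset.mem_filter] at hL hL'
      obtain ⟨s, -, -, hs⟩ := hF.existsUnique_pt_mem hL.1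
        (F.slope_ne_zero_of_mem (hF.1 L hL.1) (hF.2 L hL.1) hL.2)
      exact hqr ((hs q hL.2).trans (hs r hL'.2).symm)
  · simp [Frame.par]

theorem card_trace_le (hF : F.Avoids A) : (F.trace A).card ≤ A.card := by
  rw [← hF.sum_mult_add_card_par, Finset.card_eq_sum_ones]
  exact (Finset.sum_le_sum fun q hq => hF.one_le_mult hq).trans (Nat.le_add_right _ _)

/-- The restriction of a defining polynomial to a line. -/
theorem exists_res_defPoly (hF : F.Avoids A) : ∃ c, c ≠ 0 ∧ F.res (defPoly A) =
    Polynomial.C c * ∏ q ∈ F.trace A, (Polynomial.X - Polynomial.C q) ^ F.mult A q := by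
  classical
  have key : ∀ L ∈ A, ∃ c, c ≠ 0 ∧ F.res (frame L).form = Polynomial.C c *
      ∏ q ∈ F.trace A, if F.pt q ∈ L then Polynomial.X - Polynomial.C q else 1 := by
    intro L hL
    by_cases h : F.slope (frame L) = 0
    · refine ⟨(F.res (frame L).form).eval 0, fun h0 => ?_, ?_⟩
      · apply F.res_form_ne_zero (hF.1 L hL) (hF.2 L hL)
        rw [F.res_form_eq, h, h0]
        simp
      · rw [Finset.prod_eq_one, mul_one]
        · conv_lhs => rw [F.res_form_eq, h]
          simp
        · intro q _
          exact if_neg fun hq => F.slope_ne_zero_of_mem (hF.1 L hL) (hF.2 L hL) hq h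
    · obtain ⟨q, hq, hqL, hu⟩ := hF.existsUnique_pt_mem hL h
      refine ⟨_, h, ?_⟩
      rw [Finset.prod_eq_single_of_mem q hq fun r _ hr => if_neg fun h => hr (hu r h),
        if_pos hqL, F.res_form_eq_of_mem (hF.1 L hL) hqL]
  choose! c hc hres using key
  refine ⟨∏ L ∈ A, c L, Finset.prod_ne_zero_iff.mpr hc, ?_⟩
  rw [defPoly, map_prod, Finset.prod_congr rfl hres, Finset.prod_mul_distrib, map_prod,
    Finset.prod_comm]
  congr 1
  refine Finset.prod_congr rfl fun q _ => ?_
  rw [Finset.prod_ite, Finset.prod_const, Finset.prod_const_one, mul_one, Frame.mult]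

end Frame.Avoids

/-- The reduced equation of the trace of `A` on the line of `F`. -/
noncomputable def Frame.redPoly (F : Frame K) (A : Finset (Set (K × K))) : Polynomial K :=
  ∏ q ∈ F.trace A, (Polynomial.X - Polynomial.C q)

/-- The quotient of the equation of the trace of `A` on the line of `F` by its radical. -/
noncomputable def Frame.excPoly (F : Frame K) (A : Finset (Set (K × K))) : Polynomial K :=
  ∏ q ∈ F.trace A, (Polynomial.X - Polynomial.C q) ^ (F.mult A q - 1)

theorem Frame.natDegree_redPoly (F : Frame K) (A : Finset (Set (K × K))) :
    (F.redPoly A).natDegree = (F.trace A).card := by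
  simp [redPoly, Polynomial.natDegree_prod_of_monic, Polynomial.monic_X_sub_C]

theorem Frame.monic_redPoly (F : Frame K) (A : Finset (Set (K × K))) : (F.redPoly A).Monic :=
  Polynomial.monic_prod_of_monic _ _ fun _ _ => Polynomial.monic_X_sub_C _

theorem Frame.monic_excPoly (F : Frame K) (A : Finset (Set (K × K))) : (F.excPoly A).Monic :=
  Polynomial.monic_prod_of_monic _ _ fun _ _ => (Polynomial.monic_X_sub_C _).pow _

theorem Frame.natDegree_excPoly (F : Frame K) (A : Finset (Set (K × K))) :
    (F.excPoly A).natDegree = ∑ q ∈ F.trace A, (F.mult A q - 1) := by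
  rw [excPoly, Polynomial.natDegree_prod_of_monic _ _
    fun _ _ => (Polynomial.monic_X_sub_C _).pow _]
  simp [Polynomial.natDegree_pow]

theorem pairwise_isCoprime_X_sub_C_pow (s : Finset K) (m : K → ℕ) :
    Set.Pairwise (s : Set K) (Function.onFun IsCoprime
      fun q => (Polynomial.X - Polynomial.C q) ^ m q) := fun _ _ _ _ h =>
  (Polynomial.pairwise_coprime_X_sub_C Function.injective_id h).pow

namespace Frame.Avoids

variable {F : Frame K} {A : Finset (Set (K × K))}

theorem natDegree_excPoly_add (hF : F.Avoids A) :
    (F.excPoly A).natDegree + (F.par A).card + (F.trace A).card = A.card := by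
  have h := hF.sum_mult_add_card_par
  have h2 : ∑ q ∈ F.trace A, F.mult A q =
      ∑ q ∈ F.trace A, (F.mult A q - 1) + (F.trace A).card := by
    rw [Finset.card_eq_sum_ones, ← Finset.sum_add_distrib]
    exact Finset.sum_congr rfl fun q hq => (Nat.sub_add_cancel (hF.one_le_mult hq)).symm
  rw [F.natDegree_excPoly]
  omega

theorem exists_res_defPoly_eq (hF : F.Avoids A) : ∃ c, c ≠ 0 ∧
    F.res (defPoly A) = Polynomial.C c * (F.excPoly A * F.redPoly A) := by
  obtain ⟨c, hc, h⟩ := hF.exists_res_defPoly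
  refine ⟨c, hc, ?_⟩
  rw [h, Frame.excPoly, Frame.redPoly, ← Finset.prod_mul_distrib]
  congr 1
  refine Finset.prod_congr rfl fun q hq => ?_
  rw [← pow_succ, Nat.sub_add_cancel (hF.one_le_mult hq)]

/-- The restriction to the line of `F` of a derivation tangent to it vanishes on the trace. -/
theorem redPoly_dvd (hF : F.Avoids A) {θ : MvPolynomial (Fin 3) K × MvPolynomial (Fin 3) K}
    (hθ : IsLog A θ) (hn : F.form ∣ F.nor θ) : F.redPoly A ∣ F.res (F.tan θ) := by
  refine Finset.prod_dvd_of_coprime ?_ fun q hq => ?_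
  · simpa using pairwise_isCoprime_X_sub_C_pow (F.trace A) fun _ => 1
  · rw [Polynomial.dvd_iff_isRoot, Polynomial.IsRoot]
    obtain ⟨L, hL, hqL⟩ := hF.mem_trace.mp hq
    have h1 : F.res (frame L).form ∣ F.res ((frame L).nor θ) := map_dvd _ (hθ L hL)
    obtain ⟨g, hg⟩ := hn
    have h2 : F.res ((frame L).nor θ) =
        Polynomial.C (F.slope (frame L)) * F.res (F.tan θ) := by
      rw [Frame.nor_apply, F.fst_eq θ, F.snd_eq θ, hg]
      simp only [map_add, map_mul, map_sub, F.res_C, F.res_form, Frame.slope]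
      ring
    obtain ⟨w, hw⟩ := h1
    have h3 : (F.res ((frame L).nor θ)).eval q = 0 := by
      rw [hw, Polynomial.eval_mul, (F.eval_res_form (hF.1 L hL) q).mpr hqL, zero_mul]
    rw [h2, Polynomial.eval_mul, Polynomial.eval_C] at h3
    exact (mul_eq_zero.mp h3).resolve_left (F.slope_ne_zero_of_mem (hF.1 L hL) (hF.2 L hL) hqL)

theorem excPoly_dvd (hF : F.Avoids A) {θ : MvPolynomial (Fin 3) K × MvPolynomial (Fin 3) K}
    (hθ : IsLog A θ) : F.excPoly A ∣ F.res (F.nor θ) := by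
  classical
  refine Finset.prod_dvd_of_coprime (pairwise_isCoprime_X_sub_C_pow _ _) fun q hq => ?_
  set B := A.filter fun L => F.pt q ∈ L with hB
  have hFB : F.Avoids B := hF.mono (Finset.filter_subset _ _)
  set η : MvPolynomial (Fin 3) K × MvPolynomial (Fin 3) K :=
    (X 0 - C (F.pt q).1 * X 2, X 1 - C (F.pt q).2 * X 2) with hη
  have hηB : ∀ L : Set (K × K), IsAffineLine L → F.pt q ∈ L → (frame L).nor η = (frame L).form := by
    intro L hL hqL
    rw [← line_frame hL] at hqL
    have h : (frame L).a * (F.pt q).1 + (frame L).b * (F.pt q).2 + (frame L).c = 0 := hqL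
    have h' := congrArg (C : K → MvPolynomial (Fin 3) K) h
    simp only [C_add, C_mul, C_0] at h'
    rw [Frame.nor_apply, Frame.form, lin3, hη]
    linear_combination (-X 2) * h'
  have hdvd : defPoly B ∣ wedge θ η := by
    refine defPoly_dvd hFB.1 fun L hL => (frame L).form_dvd_wedge ?_ ?_
    · exact hθ L (Finset.mem_filter.mp hL).1
    · rw [hηB L (hFB.1 L hL) (Finset.mem_filter.mp hL).2]
  have hdvd' : F.res (defPoly B) ∣ F.res (wedge θ η) := map_dvd _ hdvd
  have hw : F.res (wedge θ η) = F.res (F.nor θ) * (Polynomial.X - Polynomial.C q) := by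
    have hnη : F.nor η = F.form := by
      have h : F.a * (F.pt q).1 + F.b * (F.pt q).2 + F.c = 0 := F.pt_mem q
      have h' := congrArg (C : K → MvPolynomial (Fin 3) K) h
      simp only [C_add, C_mul, C_0] at h'
      rw [Frame.nor_apply, Frame.form, lin3, hη]
      linear_combination (-X 2) * h'
    have htη : F.tan η = F.coord - C q * X 2 := by
      have h : F.u * (F.pt q).2 - F.v * (F.pt q).1 = q := by
        simp only [Frame.pt]
        linear_combination q * F.transverse
      have h' := congrArg (C : K → MvPolynomial (Fin 3) K) h
      simp only [C_sub, C_mul] at h'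
      rw [Frame.tan_apply, Frame.coord, hη]
      linear_combination (-X 2) * h'
    rw [wedge, F.det_eq, hnη, htη]
    simp [F.res_form, F.res_coord, F.res_C, F.res_X_two]
  rw [hw] at hdvd'
  have hpow : (Polynomial.X - Polynomial.C q) ^ (F.mult A q) ∣
      F.res (F.nor θ) * (Polynomial.X - Polynomial.C q) := by
    refine dvd_trans ?_ hdvd'
    obtain ⟨c, -, hc⟩ := hFB.exists_res_defPoly
    rw [hc]
    obtain ⟨L, hL, hqL⟩ := hF.mem_trace.mp hq
    have hqB : q ∈ F.trace B := hFB.mem_trace.mpr ⟨L, Finset.mem_filter.mpr ⟨hL, hqL⟩, hqL⟩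
    have hm : F.mult B q = F.mult A q := by
      rw [Frame.mult, Frame.mult, hB, Finset.filter_filter]
      simp
    rw [← hm]
    exact (Finset.dvd_prod_of_mem (fun q => (Polynomial.X - Polynomial.C q) ^ F.mult B q)
      hqB).mul_left _
  rw [← Nat.sub_add_cancel (hF.one_le_mult hq), pow_succ] at hpow
  exact (mul_dvd_mul_iff_right (Polynomial.X_sub_C_ne_zero q)).mp hpow

theorem natDegree_res_nor_le (hF : F.Avoids A)
    {θ : MvPolynomial (Fin 3) K × MvPolynomial (Fin 3) K} {k : ℕ} (hθ : θ ∈ logDer A k)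
    (h0 : F.nor θ ≠ 0) : (F.res (F.nor θ)).natDegree + (F.par A).card ≤ k := by
  classical
  have hP : F.Avoids (F.par A) := hF.mono (Finset.filter_subset _ _)
  have hdvd : defPoly (F.par A) ∣ F.nor θ := by
    refine defPoly_dvd hP.1 fun L hL => ?_
    obtain ⟨hL, hs⟩ := Finset.mem_filter.mp hL
    have hs' : F.a * (frame L).b - F.b * (frame L).a = 0 := hs
    set G := frame L with hG
    have hr : C G.a * F.nor θ = C F.a * G.nor θ := by
      have h' := congrArg (C : K → MvPolynomial (Fin 3) K) hs'
      simp only [C_sub, C_mul, C_0] at h'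
      rw [Frame.nor_apply, Frame.nor_apply]
      linear_combination (-θ.2) * h'
    have hr' : C G.b * F.nor θ = C F.b * G.nor θ := by
      have h' := congrArg (C : K → MvPolynomial (Fin 3) K) hs'
      simp only [C_sub, C_mul, C_0] at h'
      rw [Frame.nor_apply, Frame.nor_apply]
      linear_combination (θ.1) * h'
    have : F.nor θ = (C G.u * C F.a + C G.v * C F.b) * G.nor θ := by
      linear_combination C G.u * hr + C G.v * hr' - F.nor θ * G.C_transverse
    rw [this]
    exact (hθ.1 L hL).mul_left _
  obtain ⟨g, hg⟩ := hdvd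
  have hhom := F.isHomogeneous_nor hθ.2
  have hg0 : g ≠ 0 := by
    rintro rfl
    exact h0 (by rw [hg, mul_zero])
  have hk : (F.par A).card + g.totalDegree = k := by
    rw [← hhom.totalDegree h0, hg, totalDegree_mul_of_isDomain (defPoly_ne_zero _) hg0,
      (isHomogeneous_defPoly _).totalDegree (defPoly_ne_zero _)]
  have htr : F.trace (F.par A) = ∅ := by
    rw [Finset.eq_empty_iff_forall_notMem]
    intro q hq
    obtain ⟨L, hL, hqL⟩ := hP.mem_trace.mp hq
    exact F.slope_ne_zero_of_mem (hP.1 L hL) (hP.2 L hL) hqL (Finset.mem_filter.mp hL).2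
  obtain ⟨c, hc, hres⟩ := hP.exists_res_defPoly
  rw [htr, Finset.prod_empty, mul_one] at hres
  have := F.natDegree_res_le g
  have h2 : (F.res (F.nor θ)).natDegree = (F.res g).natDegree := by
    rw [hg, map_mul, hres, Polynomial.natDegree_C_mul hc]
  omega

end Frame.Avoids

/-! ### Dimension bounds for a deletion pair -/

namespace Frame

/-- The restriction to a line of the component of a derivation along that line. -/
noncomputable def resTan (F : Frame K) :
    MvPolynomial (Fin 3) K × MvPolynomial (Fin 3) K →ₗ[K] Polynomial K :=
  F.res.toLinearMap ∘ₗ F.tan.restrictScalars K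

/-- The restriction to a line of the component of a derivation transverse to that line. -/
noncomputable def resNor (F : Frame K) :
    MvPolynomial (Fin 3) K × MvPolynomial (Fin 3) K →ₗ[K] Polynomial K :=
  F.res.toLinearMap ∘ₗ F.nor.restrictScalars K

theorem resTan_apply (F : Frame K) (θ : MvPolynomial (Fin 3) K × MvPolynomial (Fin 3) K) :
    F.resTan θ = F.res (F.tan θ) := rfl

theorem resNor_apply (F : Frame K) (θ : MvPolynomial (Fin 3) K × MvPolynomial (Fin 3) K) :
    F.resNor θ = F.res (F.nor θ) := rfl

/-- Multiplication of derivations by the equation of a line. -/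
noncomputable def mulForm (F : Frame K) :
    MvPolynomial (Fin 3) K × MvPolynomial (Fin 3) K →ₗ[K]
      MvPolynomial (Fin 3) K × MvPolynomial (Fin 3) K :=
  (LinearMap.lsmul (MvPolynomial (Fin 3) K) _ F.form).restrictScalars K

theorem mulForm_apply (F : Frame K) (θ : MvPolynomial (Fin 3) K × MvPolynomial (Fin 3) K) :
    F.mulForm θ = F.form • θ := rfl

theorem mulForm_injective (F : Frame K) : Function.Injective F.mulForm := by
  intro θ φ h
  simp only [mulForm_apply] at h
  exact Prod.ext (mul_left_cancel₀ F.form_ne_zero (congrArg Prod.fst h))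
    (mul_left_cancel₀ F.form_ne_zero (congrArg Prod.snd h))

end Frame

theorem logDer_anti {A B : Finset (Set (K × K))} (h : A ⊆ B) (k : ℕ) : logDer B k ≤ logDer A k :=
  fun _ hθ => ⟨fun L hL => hθ.1 L (h hL), hθ.2⟩

theorem avoids_frame {A : Finset (Set (K × K))} {H : Set (K × K)} (hA : IsLineArr A)
    (hH : IsAffineLine H) (hHA : H ∉ A) : (frame H).Avoids A :=
  ⟨hA, fun L hL h => hHA (by rwa [h, line_frame hH] at hL)⟩

section

open Classical

theorem mulForm_mem {A : Finset (Set (K × K))} {H : Set (K × K)} {k : ℕ}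
    {θ : MvPolynomial (Fin 3) K × MvPolynomial (Fin 3) K} (hθ : θ ∈ logDer A k) :
    (frame H).mulForm θ ∈ logDer (insert H A) (k + 1) := by
  rw [Frame.mulForm_apply]
  refine ⟨isLog_insert.mpr ⟨?_, fun L hL => ?_⟩, ?_, ?_⟩
  · rw [map_smul, smul_eq_mul]
    exact dvd_mul_right _ _
  · rw [map_smul, smul_eq_mul]
    exact (hθ.1 L hL).mul_left _
  · rw [add_comm]
    exact (frame H).isHomogeneous_form.mul hθ.2.1
  · rw [add_comm]
    exact (frame H).isHomogeneous_form.mul hθ.2.2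

theorem exists_smul_form_eq {A : Finset (Set (K × K))} {H : Set (K × K)} {k : ℕ}
    {θ : MvPolynomial (Fin 3) K × MvPolynomial (Fin 3) K} (hθ : θ ∈ logDer (insert H A) k)
    (h : (frame H).resTan θ = 0) : ∃ η, θ = (frame H).form • η := by
  obtain ⟨t, ht⟩ := ((frame H).form_dvd_iff_res ((frame H).isHomogeneous_tan hθ.2)).mpr h
  obtain ⟨n, hn⟩ := (isLog_insert.mp hθ.1).1
  have h1 := (frame H).fst_eq θ
  have h2 := (frame H).snd_eq θ
  rw [ht, hn] at h1 h2
  refine ⟨(C (frame H).u * n - C (frame H).b * t, C (frame H).v * n + C (frame H).a * t), ?_⟩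
  refine Prod.ext ?_ ?_
  · rw [h1, Prod.smul_fst, smul_eq_mul]
    ring
  · rw [h2, Prod.smul_snd, smul_eq_mul]
    ring

theorem eq_zero_of_resTan_eq_zero {A : Finset (Set (K × K))} {H : Set (K × K)}
    {θ : MvPolynomial (Fin 3) K × MvPolynomial (Fin 3) K} (hθ : θ ∈ logDer (insert H A) 0)
    (h : (frame H).resTan θ = 0) : θ = 0 := by
  obtain ⟨η, rfl⟩ := exists_smul_form_eq hθ h
  have key (g : MvPolynomial (Fin 3) K) (hg : ((frame H).form * g).IsHomogeneous 0) :
      (frame H).form * g = 0 := by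
    rw [← homogeneousComponent_eq_self hg,
      homogeneousComponent_mul_of_lt (frame H).isHomogeneous_form g one_pos]
  exact Prod.ext (key _ hθ.2.1) (key _ hθ.2.2)

theorem mem_map_mulForm_iff {A : Finset (Set (K × K))} {H : Set (K × K)} (hA : IsLineArr A)
    (hH : IsAffineLine H) (hHA : H ∉ A) {k : ℕ}
    (θ : MvPolynomial (Fin 3) K × MvPolynomial (Fin 3) K) :
    θ ∈ (logDer A k).map (frame H).mulForm ↔
      θ ∈ logDer (insert H A) (k + 1) ∧ (frame H).resTan θ = 0 := by
  constructor
  · rintro ⟨η, hη, rfl⟩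
    refine ⟨mulForm_mem hη, ?_⟩
    rw [Frame.resTan_apply, Frame.mulForm_apply, map_smul, smul_eq_mul, map_mul, Frame.res_form,
      zero_mul]
  · rintro ⟨hθ, h⟩
    obtain ⟨η, rfl⟩ := exists_smul_form_eq hθ h
    refine ⟨η, ⟨fun L hL => ?_, ?_, ?_⟩, rfl⟩
    · have h1 := (isLog_insert.mp hθ.1).2 L hL
      rw [map_smul, smul_eq_mul] at h1
      exact ((frame L).prime_form.dvd_or_dvd h1).resolve_left
        (not_form_dvd_form (hA L hL) hH fun h => hHA (h ▸ hL))
    · exact IsHomogeneous.of_mul_left (frame H).isHomogeneous_form (frame H).form_ne_zero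
        (by rw [add_comm]; exact hθ.2.1)
    · exact IsHomogeneous.of_mul_left (frame H).isHomogeneous_form (frame H).form_ne_zero
        (by rw [add_comm]; exact hθ.2.2)

theorem map_resTan_le {A : Finset (Set (K × K))} {H : Set (K × K)} (hA : IsLineArr A)
    (hH : IsAffineLine H) (hHA : H ∉ A) (k : ℕ) :
    (logDer (insert H A) k).map (frame H).resTan ≤ mulDegreeLE ((frame H).redPoly A) k := by
  rintro _ ⟨θ, hθ, rfl⟩
  have h := isLog_insert.mp hθ.1
  refine mem_mulDegreeLE ((frame H).monic_redPoly A).ne_zero ?_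
    ((avoids_frame hA hH hHA).redPoly_dvd h.2 h.1)
  exact ((frame H).natDegree_res_le _).trans
    ((frame H).isHomogeneous_tan hθ.2).totalDegree_le

theorem finrank_map_resTan_le {A : Finset (Set (K × K))} {H : Set (K × K)} (hA : IsLineArr A)
    (hH : IsAffineLine H) (hHA : H ∉ A) (k : ℕ) :
    Module.finrank K ((logDer (insert H A) k).map (frame H).resTan) ≤
      k + 1 - ((frame H).trace A).card := by
  rw [← Frame.natDegree_redPoly, ← finrank_mulDegreeLE ((frame H).monic_redPoly A).ne_zero]
  exact Submodule.finrank_mono (map_resTan_le hA hH hHA k)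

theorem finrank_logDer_insert_zero {A : Finset (Set (K × K))} {H : Set (K × K)} :
    Module.finrank K (logDer (insert H A) 0) =
      Module.finrank K ((logDer (insert H A) 0).map (frame H).resTan) := by
  rw [finrank_eq_add_of_map_eq (frame H).resTan (M := logDer (insert H A) 0) (M' := ⊥),
    finrank_bot, add_zero]
  intro θ
  rw [Submodule.mem_bot]
  refine ⟨?_, fun h => eq_zero_of_resTan_eq_zero h.1 h.2⟩
  rintro rfl
  exact ⟨zero_mem _, map_zero _⟩

theorem finrank_logDer_insert_succ {A : Finset (Set (K × K))} {H : Set (K × K)}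
    (hA : IsLineArr A) (hH : IsAffineLine H) (hHA : H ∉ A) (k : ℕ) :
    Module.finrank K (logDer (insert H A) (k + 1)) =
      Module.finrank K ((logDer (insert H A) (k + 1)).map (frame H).resTan) +
        Module.finrank K (logDer A k) := by
  rw [finrank_eq_add_of_map_eq (frame H).resTan (M := logDer (insert H A) (k + 1))
    (mem_map_mulForm_iff hA hH hHA)]
  congr 1
  exact (Submodule.equivMapOfInjective _ (frame H).mulForm_injective _).symm.finrank_eq

theorem finrank_logDer {A : Finset (Set (K × K))} {H : Set (K × K)} (k : ℕ) :
    Module.finrank K (logDer A k) =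
      Module.finrank K ((logDer A k).map (frame H).resNor) +
        Module.finrank K (logDer (insert H A) k) := by
  refine finrank_eq_add_of_map_eq (frame H).resNor fun θ => ?_
  constructor
  · intro h
    refine ⟨logDer_anti (Finset.subset_insert _ _) k h, ?_⟩
    obtain ⟨g, hg⟩ := (isLog_insert.mp h.1).1
    rw [Frame.resNor_apply, hg, map_mul, Frame.res_form, zero_mul]
  · rintro ⟨h, h0⟩
    exact ⟨isLog_insert.mpr
      ⟨((frame H).form_dvd_iff_res ((frame H).isHomogeneous_nor h.2)).mpr h0, h.1⟩, h.2⟩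

end

namespace Frame.Avoids

variable {F : Frame K} {A : Finset (Set (K × K))}

theorem map_resNor_le (hF : F.Avoids A) {k : ℕ} (hk : (F.par A).card ≤ k) :
    (logDer A k).map F.resNor ≤ mulDegreeLE (F.excPoly A) (k - (F.par A).card) := by
  rintro _ ⟨θ, hθ, rfl⟩
  refine mem_mulDegreeLE (F.monic_excPoly A).ne_zero ?_ (hF.excPoly_dvd hθ.1)
  by_cases h0 : F.nor θ = 0
  · rw [resNor_apply, h0, map_zero, Polynomial.natDegree_zero]
    exact Nat.zero_le _
  · have := hF.natDegree_res_nor_le hθ h0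
    rw [resNor_apply]
    omega

theorem finrank_map_resNor_le (hF : F.Avoids A) (k : ℕ) :
    Module.finrank K ((logDer A k).map F.resNor) ≤ k + 1 - (A.card - (F.trace A).card) := by
  by_cases hk : (F.par A).card ≤ k
  · refine (Submodule.finrank_mono (hF.map_resNor_le hk)).trans ?_
    rw [finrank_mulDegreeLE (F.monic_excPoly A).ne_zero]
    have := hF.natDegree_excPoly_add
    omega
  · have : (logDer A k).map F.resNor = ⊥ := by
      rw [eq_bot_iff]
      rintro _ ⟨θ, hθ, rfl⟩
      by_cases h0 : F.nor θ = 0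
      · rw [resNor_apply, h0, map_zero]
        exact zero_mem _
      · have := hF.natDegree_res_nor_le hθ h0
        omega
    rw [this, finrank_bot]
    exact Nat.zero_le _

theorem excPoly_mul_redPoly_mul_mem (hF : F.Avoids A) {k : ℕ} (hk : A.card ≤ k)
    {t : Polynomial K} (ht : t.natDegree ≤ k - A.card) :
    F.excPoly A * (F.redPoly A * t) ∈ (logDer A k).map F.resNor := by
  obtain ⟨s, hs, rfl⟩ := F.exists_res_eq ht
  obtain ⟨c, hc, hres⟩ := hF.exists_res_defPoly_eq
  have hhom : (defPoly A * s).IsHomogeneous k := by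
    have := (isHomogeneous_defPoly A).mul hs
    rwa [Nat.add_sub_cancel' hk] at this
  have hmem : (defPoly A * s) • ((C F.u, C F.v) :
      MvPolynomial (Fin 3) K × MvPolynomial (Fin 3) K) ∈ logDer A k := by
    refine ⟨fun L hL => ?_, ?_, ?_⟩
    · rw [map_smul, smul_eq_mul, mul_assoc]
      exact (Finset.dvd_prod_of_mem (fun L => (frame L).form) hL).mul_right _
    · exact hhom.mul (isHomogeneous_C _ _)
    · exact hhom.mul (isHomogeneous_C _ _)
  have h1 := Submodule.smul_mem _ c⁻¹ (Submodule.mem_map_of_mem (f := F.resNor) hmem)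
  convert h1 using 1
  rw [resNor_apply, map_smul, nor_apply, smul_eq_mul, F.C_transverse, mul_one, map_mul, hres,
    Polynomial.smul_eq_C_mul]
  have hcc : Polynomial.C c⁻¹ * Polynomial.C c = 1 := by
    rw [← Polynomial.C_mul, inv_mul_cancel₀ hc, Polynomial.C_1]
  linear_combination (-F.excPoly A * F.redPoly A * F.res s) * hcc

open Classical in
theorem excPoly_mul_prod_erase_mem (hF : F.Avoids A) {k : ℕ} (hk : A.card ≤ k) {q : K}
    (hq : q ∈ F.trace A) :
    F.excPoly A * (∏ r ∈ (F.trace A).erase q, (Polynomial.X - Polynomial.C r)) ∈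
      (logDer A k).map F.resNor := by
  obtain ⟨L, hL, hqL⟩ := hF.mem_trace.mp hq
  set G := frame L with hG
  obtain ⟨c, hc, hres⟩ := hF.exists_res_defPoly_eq
  have hcard : (A.erase L).card + 1 = A.card := Finset.card_erase_add_one hL
  obtain ⟨s, hs, hs1⟩ := F.exists_res_eq (g := (1 : Polynomial K)) (k := k - (A.erase L).card)
    (by simp)
  have hhom : (defPoly (A.erase L) * s).IsHomogeneous k := by
    have := (isHomogeneous_defPoly (A.erase L)).mul hs
    rwa [Nat.add_sub_cancel' (by omega)] at this
  have hmem : (defPoly (A.erase L) * s) • ((-C G.b, C G.a) :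
      MvPolynomial (Fin 3) K × MvPolynomial (Fin 3) K) ∈ logDer A k := by
    refine ⟨fun M hM => ?_, ?_, ?_⟩
    · rcases eq_or_ne M L with rfl | hML
      · rw [map_smul, nor_apply]
        simp only
        rw [show C (frame M).a * -C G.b + C (frame M).b * C G.a = (0 : MvPolynomial (Fin 3) K) by
          rw [hG]; ring, smul_zero]
        exact dvd_zero _
      · rw [map_smul, smul_eq_mul, mul_assoc]
        exact (Finset.dvd_prod_of_mem (fun L => (frame L).form)
          (Finset.mem_erase.mpr ⟨hML, hM⟩)).mul_right _
    · exact hhom.mul (isHomogeneous_C _ _).neg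
    · exact hhom.mul (isHomogeneous_C _ _)
  have h1 := Submodule.smul_mem _ (-c⁻¹) (Submodule.mem_map_of_mem (f := F.resNor) hmem)
  convert h1 using 1
  have hsplit : defPoly A = G.form * defPoly (A.erase L) :=
    (Finset.mul_prod_erase A (fun L => (frame L).form) hL).symm
  have hred : F.redPoly A = (Polynomial.X - Polynomial.C q) *
      ∏ r ∈ (F.trace A).erase q, (Polynomial.X - Polynomial.C r) :=
    (Finset.mul_prod_erase _ _ hq).symm
  rw [hsplit, map_mul, hG, F.res_form_eq_of_mem (hF.1 L hL) hqL, ← hG, hred] at hres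
  have hcan : Polynomial.C (F.slope G) * F.res (defPoly (A.erase L)) = Polynomial.C c *
      (F.excPoly A * ∏ r ∈ (F.trace A).erase q, (Polynomial.X - Polynomial.C r)) := by
    apply mul_left_cancel₀ (Polynomial.X_sub_C_ne_zero q)
    linear_combination hres
  have hcc : Polynomial.C c⁻¹ * Polynomial.C c = 1 := by
    rw [← Polynomial.C_mul, inv_mul_cancel₀ hc, Polynomial.C_1]
  have hn : F.res (C F.a * -C G.b + C F.b * C G.a) = -Polynomial.C (F.slope G) := by
    simp only [map_add, map_mul, map_neg, F.res_C, slope, map_sub]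
    ring
  rw [resNor_apply, map_smul, nor_apply, smul_eq_mul, map_mul, map_mul, hs1, hn,
    Polynomial.smul_eq_C_mul, Polynomial.C_neg]
  linear_combination (-(F.excPoly A *
    ∏ r ∈ (F.trace A).erase q, (Polynomial.X - Polynomial.C r))) * hcc -
      Polynomial.C c⁻¹ * hcan

theorem excPoly_mul_mem (hF : F.Avoids A) {k : ℕ} (hk : A.card ≤ k) {g : Polynomial K}
    (hg : g.natDegree ≤ k - (A.card - (F.trace A).card)) :
    F.excPoly A * g ∈ (logDer A k).map F.resNor := by
  classical
  have hle := hF.card_trace_le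
  rw [← Polynomial.modByMonic_add_div g (F.redPoly A), mul_add]
  refine add_mem ?_ (hF.excPoly_mul_redPoly_mul_mem hk ?_)
  · have hdeg : (g %ₘ F.redPoly A).degree < (F.trace A).card := by
      rw [← F.natDegree_redPoly, ← Polynomial.degree_eq_natDegree (F.monic_redPoly A).ne_zero]
      exact Polynomial.degree_modByMonic_lt g (F.monic_redPoly A)
    rw [Lagrange.eq_interpolate (v := id) Function.injective_id.injOn hdeg,
      Lagrange.interpolate_apply, Finset.mul_sum]
    refine sum_mem fun q hq => ?_
    have hb : ∃ d, Lagrange.basis (F.trace A) id q = Polynomial.C d *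
        ∏ r ∈ (F.trace A).erase q, (Polynomial.X - Polynomial.C r) := by
      refine ⟨∏ r ∈ (F.trace A).erase q, (q - r)⁻¹, ?_⟩
      rw [Lagrange.basis, map_prod, ← Finset.prod_mul_distrib]
      rfl
    obtain ⟨d, hd⟩ := hb
    have h1 := Submodule.smul_mem _ (Polynomial.eval q (g %ₘ F.redPoly A) * d)
      (hF.excPoly_mul_prod_erase_mem hk hq)
    convert h1 using 1
    rw [hd, Polynomial.smul_eq_C_mul, Polynomial.C_mul, id]
    ring
  · rw [Polynomial.natDegree_divByMonic g (F.monic_redPoly A), F.natDegree_redPoly]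
    omega

theorem finrank_map_resNor (hF : F.Avoids A) {k : ℕ} (hk : A.card ≤ k) :
    Module.finrank K ((logDer A k).map F.resNor) = k + 1 - (A.card - (F.trace A).card) := by
  refine le_antisymm (hF.finrank_map_resNor_le k) ?_
  have hdeg := hF.natDegree_excPoly_add
  have : mulDegreeLE (F.excPoly A) (k - (F.par A).card) ≤ (logDer A k).map F.resNor := by
    rintro _ ⟨g, hg, rfl⟩
    refine hF.excPoly_mul_mem hk ?_
    rw [SetLike.mem_coe, Polynomial.mem_degreeLT] at hg
    rcases eq_or_ne g 0 with rfl | hg0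
    · simp
    · rw [Polynomial.degree_eq_natDegree hg0] at hg
      have : g.natDegree < k - (F.par A).card + 1 - (F.excPoly A).natDegree := by
        exact_mod_cast hg
      omega
  have h2 := Submodule.finrank_mono this
  rw [finrank_mulDegreeLE (F.monic_excPoly A).ne_zero] at h2
  omega

end Frame.Avoids

/-! ### Hilbert functions -/

section Basis

variable {A : Finset (Set (K × K))}
  {θ₁ θ₂ : MvPolynomial (Fin 3) K × MvPolynomial (Fin 3) K} {d₁ d₂ : ℕ}

theorem exists_homogeneous_coeff {k k₁ k₂ : ℕ}
    (h₁ : θ₁.1.IsHomogeneous d₁ ∧ θ₁.2.IsHomogeneous d₁)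
    (h₂ : θ₂.1.IsHomogeneous d₂ ∧ θ₂.2.IsHomogeneous d₂) (hk₁ : d₁ + k₁ = k) (hk₂ : d₂ + k₂ = k)
    {c : MvPolynomial (Fin 3) K × MvPolynomial (Fin 3) K}
    (hθ : (c.1 • θ₁ + c.2 • θ₂).1.IsHomogeneous k ∧ (c.1 • θ₁ + c.2 • θ₂).2.IsHomogeneous k) :
    c.1 • θ₁ + c.2 • θ₂ =
      homogeneousComponent k₁ c.1 • θ₁ + homogeneousComponent k₂ c.2 • θ₂ := by
  have key {f g : MvPolynomial (Fin 3) K} (hf : f.IsHomogeneous d₁) (hg : g.IsHomogeneous d₂)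
      (h : (c.1 * f + c.2 * g).IsHomogeneous k) : c.1 * f + c.2 * g =
        homogeneousComponent k₁ c.1 * f + homogeneousComponent k₂ c.2 * g := by
    conv_lhs => rw [← homogeneousComponent_eq_self h, map_add, mul_comm c.1, mul_comm c.2]
    conv_lhs => arg 1; rw [← hk₁]
    conv_lhs => arg 2; rw [← hk₂]
    rw [homogeneousComponent_add_mul hf, homogeneousComponent_add_mul hg, mul_comm f, mul_comm g]
  exact Prod.ext (key h₁.1 h₂.1 hθ.1) (key h₁.2 h₂.2 hθ.2)

/-- The Hilbert function of the module of logarithmic derivations of a free arrangement. -/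
theorem finrank_logDer_of_basis {k k₁ k₂ : ℕ} (hl₁ : IsLog A θ₁) (hl₂ : IsLog A θ₂)
    (h₁ : θ₁.1.IsHomogeneous d₁ ∧ θ₁.2.IsHomogeneous d₁)
    (h₂ : θ₂.1.IsHomogeneous d₂ ∧ θ₂.2.IsHomogeneous d₂)
    (H : ∀ θ, IsLog A θ → ∃! c : MvPolynomial (Fin 3) K × MvPolynomial (Fin 3) K,
      θ = c.1 • θ₁ + c.2 • θ₂) (hk₁ : d₁ + k₁ = k) (hk₂ : d₂ + k₂ = k) :
    Module.finrank K (logDer A k) = (k₁ + 2).choose 2 + (k₂ + 2).choose 2 := by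
  let T : homogeneousSubmodule (Fin 3) K k₁ × homogeneousSubmodule (Fin 3) K k₂ →ₗ[K]
      MvPolynomial (Fin 3) K × MvPolynomial (Fin 3) K :=
    (((LinearMap.toSpanSingleton (MvPolynomial (Fin 3) K) _ θ₁).restrictScalars K) ∘ₗ
      (homogeneousSubmodule (Fin 3) K k₁).subtype).coprod
    (((LinearMap.toSpanSingleton (MvPolynomial (Fin 3) K) _ θ₂).restrictScalars K) ∘ₗ
      (homogeneousSubmodule (Fin 3) K k₂).subtype)
  have hT (x) : T x = (x.1 : MvPolynomial (Fin 3) K) • θ₁ +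
      (x.2 : MvPolynomial (Fin 3) K) • θ₂ := rfl
  have hinj : Function.Injective T := by
    rw [injective_iff_map_eq_zero]
    intro x hx
    rw [hT] at hx
    have h0 : IsLog A 0 := fun L _ => by simp
    obtain ⟨c, -, hc⟩ := H 0 h0
    have h1 := (hc (x.1, x.2) hx.symm).trans (hc 0 (by simp)).symm
    exact Prod.ext (Subtype.ext (congrArg Prod.fst h1)) (Subtype.ext (congrArg Prod.snd h1))
  have hrange : LinearMap.range T = logDer A k := by
    ext θ
    constructor
    · rintro ⟨⟨⟨f, hf⟩, ⟨g, hg⟩⟩, rfl⟩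
      rw [hT]
      rw [mem_homogeneousSubmodule] at hf hg
      refine ⟨fun L hL => ?_, ?_, ?_⟩
      · rw [map_add, map_smul, map_smul]
        exact dvd_add ((hl₁ L hL).mul_left _) ((hl₂ L hL).mul_left _)
      · refine IsHomogeneous.add ?_ ?_
        · rw [← hk₁, add_comm]
          exact hf.mul h₁.1
        · rw [← hk₂, add_comm]
          exact hg.mul h₂.1
      · refine IsHomogeneous.add ?_ ?_
        · rw [← hk₁, add_comm]
          exact hf.mul h₁.2
        · rw [← hk₂, add_comm]
          exact hg.mul h₂.2
    · intro hθ
      obtain ⟨c, hc, -⟩ := H θ hθ.1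
      refine ⟨(⟨_, homogeneousComponent_mem k₁ c.1⟩, ⟨_, homogeneousComponent_mem k₂ c.2⟩), ?_⟩
      subst hc
      exact (exists_homogeneous_coeff h₁ h₂ hk₁ hk₂ hθ.2).symm
  rw [← hrange, ← (LinearEquiv.ofInjective T hinj).finrank_eq, Module.finrank_prod,
    finrank_homogeneousSubmodule_fin_three, finrank_homogeneousSubmodule_fin_three]

theorem logDer_eq_bot_of_lt {k : ℕ} (h₁ : θ₁.1.IsHomogeneous d₁ ∧ θ₁.2.IsHomogeneous d₁)
    (h₂ : θ₂.1.IsHomogeneous d₂ ∧ θ₂.2.IsHomogeneous d₂)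
    (H : ∀ θ, IsLog A θ → ∃! c : MvPolynomial (Fin 3) K × MvPolynomial (Fin 3) K,
      θ = c.1 • θ₁ + c.2 • θ₂) (hk₁ : k < d₁) (hk₂ : k < d₂) : logDer A k = ⊥ := by
  rw [eq_bot_iff]
  intro θ hθ
  obtain ⟨c, rfl, -⟩ := H θ hθ.1
  have key {f g : MvPolynomial (Fin 3) K} (hf : f.IsHomogeneous d₁) (hg : g.IsHomogeneous d₂)
      (h : (c.1 * f + c.2 * g).IsHomogeneous k) : c.1 * f + c.2 * g = 0 := by
    rw [← homogeneousComponent_eq_self h, map_add, mul_comm c.1, mul_comm c.2,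
      homogeneousComponent_mul_of_lt hf _ hk₁, homogeneousComponent_mul_of_lt hg _ hk₂, add_zero]
  exact Prod.ext (key h₁.1 h₂.1 hθ.2.1) (key h₁.2 h₂.2 hθ.2.2)

theorem ne_zero_of_basis
    (H : ∀ θ, IsLog A θ → ∃! c : MvPolynomial (Fin 3) K × MvPolynomial (Fin 3) K,
      θ = c.1 • θ₁ + c.2 • θ₂) : θ₁ ≠ 0 ∧ θ₂ ≠ 0 := by
  have h0 : IsLog A 0 := fun L _ => by simp
  obtain ⟨c, -, hc⟩ := H 0 h0
  constructor
  · rintro rfl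
    have h1 := (hc (1, 0) (by simp)).trans (hc 0 (by simp)).symm
    exact one_ne_zero (congrArg Prod.fst h1)
  · rintro rfl
    have h1 := (hc (0, 1) (by simp)).trans (hc 0 (by simp)).symm
    exact one_ne_zero (congrArg Prod.snd h1)

end Basis

theorem finrank_logDer_empty (k : ℕ) :
    Module.finrank K (logDer (∅ : Finset (Set (K × K))) k) = (k + 2) * (k + 1) := by
  rw [finrank_logDer_of_basis (θ₁ := (1, 0)) (θ₂ := (0, 1)) (d₁ := 0) (d₂ := 0) (k₁ := k)
    (k₂ := k) (by simp [IsLog]) (by simp [IsLog])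
    ⟨isHomogeneous_one _ _, isHomogeneous_zero _ _ _⟩
    ⟨isHomogeneous_zero _ _ _, isHomogeneous_one _ _⟩ ?_ (zero_add _) (zero_add _)]
  · rw [Nat.choose_two_right, ← two_mul, Nat.mul_div_cancel']
    · simp
    · exact (Nat.even_mul_pred_self _).two_dvd
  · intro θ _
    refine ⟨θ, by simp, ?_⟩
    rintro c rfl
    simp

/-! ### The second Betti number under deletion -/

open Classical in
theorem b2_insert {A : Finset (Set (K × K))} {H : Set (K × K)} (hA : IsLineArr A)
    (hH : IsAffineLine H) (hHA : H ∉ A) :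
    b2 (insert H A) = b2 A + ((frame H).trace A).card := by
  have hF := avoids_frame hA hH hHA
  set F := frame H with hFdef
  have hFH : F.line = H := line_frame hH
  rw [b2, Finset.sum_filter, Finset.sum_powerset_insert hHA, b2, Finset.sum_filter]
  congr 1
  have h1 : ∀ B ∈ A.powerset, (if 2 ≤ (insert H B).card ∧
      (⋂ L ∈ insert H B, (L : Set (K × K))).Nonempty then (-1 : ℤ) ^ (insert H B).card else 0) =
      ∑ q ∈ F.trace A, if B ≠ ∅ ∧ ∀ L ∈ B, F.pt q ∈ L then (-1 : ℤ) ^ (B.card + 1) else 0 := by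
    intro B hB
    rw [Finset.mem_powerset] at hB
    rw [Finset.card_insert_of_notMem fun h => hHA (hB h)]
    rcases B.eq_empty_or_nonempty with rfl | hne
    · simp
    obtain ⟨M, hM⟩ := hne
    have hne : B ≠ ∅ := Finset.ne_empty_of_mem hM
    by_cases h : ∃ q, ∀ L ∈ B, F.pt q ∈ L
    · obtain ⟨q, hq⟩ := h
      have hqt : q ∈ F.trace A := hF.mem_trace.mpr ⟨M, hB hM, hq M hM⟩
      obtain ⟨r, -, -, hr⟩ := hF.existsUnique_pt_mem (hB hM)
        (F.slope_ne_zero_of_mem (hF.1 M (hB hM)) (hF.2 M (hB hM)) (hq M hM))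
      rw [Finset.sum_eq_single_of_mem q hqt, if_pos, if_pos ⟨hne, hq⟩]
      · refine ⟨Nat.succ_le_succ (Finset.card_pos.mpr ⟨M, hM⟩), F.pt q, ?_⟩
        simp only [Set.mem_iInter, Finset.mem_insert]
        rintro L (rfl | hL)
        · rw [← hFH]
          exact F.pt_mem q
        · exact hq L hL
      · intro s _ hs
        exact if_neg fun h => hs ((hr s (h.2 M hM)).trans (hr q (hq M hM)).symm)
    · rw [Finset.sum_eq_zero fun q _ => if_neg fun h' => h ⟨q, h'.2⟩, if_neg]
      rintro ⟨-, p, hp⟩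
      simp only [Set.mem_iInter, Finset.mem_insert] at hp
      have hpH := hp H (Or.inl rfl)
      rw [← hFH] at hpH
      obtain ⟨q, rfl⟩ := F.exists_pt hpH
      exact h ⟨q, fun L hL => hp L (Or.inr hL)⟩
  rw [Finset.sum_congr rfl h1, Finset.sum_comm, Finset.card_eq_sum_ones, Nat.cast_sum]
  refine Finset.sum_congr rfl fun q hq => ?_
  obtain ⟨M, hM, hqM⟩ := hF.mem_trace.mp hq
  have h2 : A.powerset.filter (fun B => B ≠ ∅ ∧ ∀ L ∈ B, F.pt q ∈ L) =
      (A.filter fun L => F.pt q ∈ L).powerset.erase ∅ := by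
    ext B
    simp only [Finset.mem_filter, Finset.mem_powerset, Finset.mem_erase, Finset.subset_iff]
    constructor
    · rintro ⟨hB, hne, h⟩
      exact ⟨hne, fun L hL => ⟨hB hL, h L hL⟩⟩
    · rintro ⟨hne, h⟩
      exact ⟨fun L hL => (h hL).1, hne, fun L hL => (h hL).2⟩
  have h3 := Finset.sum_powerset_neg_one_pow_card_of_nonempty
    (x := A.filter fun L => F.pt q ∈ L) ⟨M, Finset.mem_filter.mpr ⟨hM, hqM⟩⟩
  rw [← Finset.add_sum_erase _ _ (Finset.empty_mem_powerset _)] at h3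
  rw [← Finset.sum_filter, h2]
  simp only [pow_succ, ← Finset.sum_mul]
  simp only [Finset.card_empty, pow_zero] at h3
  push_cast
  linarith

theorem two_mul_finrank_logDer (A : Finset (Set (K × K))) (hA : IsLineArr A) (k : ℕ)
    (hk : A.card ≤ k) : (2 * Module.finrank K (logDer A k) : ℤ) =
      2 * (k + 1) * (k + 2) - 2 * A.card * (k + 1) + A.card * (A.card - 1) - 2 * b2 A := by
  classical
  induction A using Finset.induction_on with
  | empty =>
    rw [finrank_logDer_empty]
    have : b2 (∅ : Finset (Set (K × K))) = 0 := by
      rw [b2, Finset.filter_eq_empty_iff.mpr, Finset.sum_empty]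
      simp
    rw [this]
    push_cast
    simp
    ring
  | insert H A hHA ih =>
    have hA' : IsLineArr A := fun L hL => hA L (Finset.mem_insert_of_mem hL)
    have hH := hA H (Finset.mem_insert_self H A)
    have hF := avoids_frame hA' hH hHA
    rw [Finset.card_insert_of_notMem hHA] at hk ⊢
    have h1 := ih hA' (by omega)
    rw [finrank_logDer (H := H) k, hF.finrank_map_resNor (by omega)] at h1
    have hle := hF.card_trace_le
    rw [b2_insert hA' hH hHA]
    push_cast [Nat.cast_sub (show A.card - ((frame H).trace A).card ≤ k + 1 by omega),
      Nat.cast_sub hle] at h1 ⊢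
    linarith

/-! ### Exponents and the characteristic polynomial -/

theorem two_mul_choose_two (k : ℕ) : (2 * ((k + 2).choose 2 : ℕ) : ℤ) = (k + 2) * (k + 1) := by
  have : 2 * (k + 2).choose 2 = (k + 2) * (k + 1) := by
    rw [Nat.choose_two_right, Nat.mul_div_cancel' (Nat.even_mul_pred_self _).two_dvd]
    simp
  exact_mod_cast this

theorem IsFreeExp.add_eq_and_mul_eq {A : Finset (Set (K × K))} (hA : IsLineArr A) {d₁ d₂ : ℕ}
    (h : IsFreeExp A d₁ d₂) : d₁ + d₂ = A.card ∧ (d₁ * d₂ : ℤ) = b2 A := by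
  obtain ⟨θ₁, θ₂, hl₁, hl₂, h₁, h₂, H⟩ := (isFreeExp_iff hA d₁ d₂).mp h
  have key (j : ℕ) := two_mul_finrank_logDer A hA (A.card + d₁ + d₂ + j) (by omega)
  have hilb (j : ℕ) := finrank_logDer_of_basis (k := A.card + d₁ + d₂ + j)
    (k₁ := A.card + d₂ + j) (k₂ := A.card + d₁ + j) hl₁ hl₂ h₁ h₂ H (by omega) (by omega)
  have e (j : ℕ) : ((A.card + d₂ + j + 2) * (A.card + d₂ + j + 1) +
      (A.card + d₁ + j + 2) * (A.card + d₁ + j + 1) : ℤ) =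
      2 * (A.card + d₁ + d₂ + j + 1) * (A.card + d₁ + d₂ + j + 2) -
        2 * A.card * (A.card + d₁ + d₂ + j + 1) + A.card * (A.card - 1) - 2 * b2 A := by
    have h1 := key j
    rw [hilb j] at h1
    have h2 := two_mul_choose_two (A.card + d₂ + j)
    have h3 := two_mul_choose_two (A.card + d₁ + j)
    push_cast at h1 h2 h3
    linarith
  have e0 := e 0
  have e1 := e 1
  push_cast at e0 e1
  have hsum : (d₁ + d₂ : ℤ) = A.card := by linarith
  refine ⟨by exact_mod_cast hsum, ?_⟩
  rw [← hsum] at e0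
  linarith

theorem IsFreeExp.chi_eq {A : Finset (Set (K × K))} (hA : IsLineArr A) {d₁ d₂ : ℕ}
    (h : IsFreeExp A d₁ d₂) (z : ℂ) : chi A z = (z - d₁) * (z - d₂) := by
  obtain ⟨hs, hp⟩ := h.add_eq_and_mul_eq hA
  rw [chi, ← hs, ← hp]
  push_cast
  ring

theorem IsFreeExp.exists_ne_zero {A : Finset (Set (K × K))} (hA : IsLineArr A) {d₁ d₂ : ℕ}
    (h : IsFreeExp A d₁ d₂) : ∃ θ ∈ logDer A (min d₁ d₂), θ ≠ 0 := by
  obtain ⟨θ₁, θ₂, hl₁, hl₂, h₁, h₂, H⟩ := (isFreeExp_iff hA d₁ d₂).mp h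
  rcases le_total d₁ d₂ with hd | hd
  · rw [min_eq_left hd]
    exact ⟨θ₁, ⟨hl₁, h₁⟩, (ne_zero_of_basis H).1⟩
  · rw [min_eq_right hd]
    exact ⟨θ₂, ⟨hl₂, h₂⟩, (ne_zero_of_basis H).2⟩

theorem IsFreeExp.min_le {A : Finset (Set (K × K))} (hA : IsLineArr A) {d₁ d₂ k : ℕ}
    (h : IsFreeExp A d₁ d₂) {θ : MvPolynomial (Fin 3) K × MvPolynomial (Fin 3) K}
    (hθ : θ ∈ logDer A k) (h0 : θ ≠ 0) : min d₁ d₂ ≤ k := by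
  obtain ⟨θ₁, θ₂, hl₁, hl₂, h₁, h₂, H⟩ := (isFreeExp_iff hA d₁ d₂).mp h
  by_contra! hk
  rw [logDer_eq_bot_of_lt h₁ h₂ H (lt_min_iff.mp hk).1 (lt_min_iff.mp hk).2] at hθ
  exact h0 hθ

/-! ### Deletion pairs -/

theorem two_mul_sum_range_succ_sub (N m : ℕ) :
    2 * ∑ j ∈ Finset.range N, (j + 1 - m) = (N - m) * (N - m + 1) := by
  induction N with
  | zero => simp
  | succ N ih =>
    rw [Finset.sum_range_succ, mul_add, ih]
    rcases le_or_gt m N with h | h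
    · obtain ⟨t, rfl⟩ := Nat.exists_eq_add_of_le h
      rw [Nat.add_sub_cancel_left, add_assoc, Nat.add_sub_cancel_left]
      ring
    · rw [Nat.sub_eq_zero_of_le h.le, Nat.sub_eq_zero_of_le (show N + 1 ≤ m from h)]

section

open Classical

variable {A : Finset (Set (K × K))} {H : Set (K × K)}

theorem finrank_logDer_insert_eq_sum (hA : IsLineArr A) (hH : IsAffineLine H) (hHA : H ∉ A)
    (k : ℕ) : Module.finrank K (logDer (insert H A) k) =
      ∑ j ∈ Finset.range (k + 1),
        Module.finrank K ((logDer (insert H A) j).map (frame H).resTan) +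
      ∑ j ∈ Finset.range k, Module.finrank K ((logDer A j).map (frame H).resNor) := by
  induction k with
  | zero => simp [finrank_logDer_insert_zero]
  | succ k ih =>
    rw [finrank_logDer_insert_succ hA hH hHA, finrank_logDer (H := H), ih]
    simp only [Finset.sum_range_succ]
    ring

theorem isLineArr_insert (hA : IsLineArr A) (hH : IsAffineLine H) : IsLineArr (insert H A) :=
  (Finset.forall_mem_insert ..).mpr ⟨hH, hA⟩

/-- If `b₂(A)` is as for a free deletion pair, then the dimension bounds are attained. -/
theorem finrank_map_eq_of_b2_eq (hA : IsLineArr A) (hH : IsAffineLine H) (hHA : H ∉ A)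
    (hb : b2 A = ((frame H).trace A).card * (A.card - ((frame H).trace A).card : ℕ)) :
    Module.finrank K ((logDer (insert H A) ((frame H).trace A).card).map (frame H).resTan) = 1 ∧
    Module.finrank K ((logDer A (A.card - ((frame H).trace A).card)).map (frame H).resNor) = 1 := by
  have hF := avoids_frame hA hH hHA
  have hle := hF.card_trace_le
  have hb' := b2_insert hA hH hHA
  have hR := two_mul_finrank_logDer _ (isLineArr_insert hA hH) (A.card + 1)
    (by rw [Finset.card_insert_of_notMem hHA])
  rw [finrank_logDer_insert_eq_sum hA hH hHA, hb', hb, Finset.card_insert_of_notMem hHA] at hR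
  have bT := fun j (_ : j ∈ Finset.range (A.card + 1 + 1)) => finrank_map_resTan_le hA hH hHA j
  have bN := fun j (_ : j ∈ Finset.range (A.card + 1)) => hF.finrank_map_resNor_le j
  have sT := Finset.sum_le_sum bT
  have sN := Finset.sum_le_sum bN
  have cT := two_mul_sum_range_succ_sub (A.card + 1 + 1) ((frame H).trace A).card
  have cN := two_mul_sum_range_succ_sub (A.card + 1) (A.card - ((frame H).trace A).card)
  have eT := Finset.sum_eq_sum_iff_of_le bT
  have eN := Finset.sum_eq_sum_iff_of_le bN
  set h := ((frame H).trace A).card with hh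
  set e := A.card - h with he
  have hcard : (A.card : ℤ) = h + e := by omega
  rw [show A.card + 1 + 1 - h = e + 2 by omega] at cT
  rw [show A.card + 1 - e = h + 1 by omega] at cN
  zify at sT sN cT cN
  push_cast at hR
  rw [hcard] at hR
  have hT := eT.mp (by zify; linarith) h (Finset.mem_range.mpr (by omega))
  have hN := eN.mp (by zify; linarith) e (Finset.mem_range.mpr (by omega))
  rw [hT, hN]
  omega

theorem exists_map_ne_zero {V W : Type*} [AddCommGroup V] [Module K V] [AddCommGroup W]
    [Module K W] {f : V →ₗ[K] W} {M : Submodule K V} (h : Module.finrank K (M.map f) = 1) :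
    ∃ x ∈ M, f x ≠ 0 := by
  by_contra! h0
  have : M.map f = ⊥ := by
    rw [eq_bot_iff]
    rintro _ ⟨x, hx, rfl⟩
    exact h0 x hx
  rw [this, finrank_bot] at h
  exact zero_ne_one h

theorem isFree_pair_of_b2_eq (hA : IsLineArr A) (hH : IsAffineLine H) (hHA : H ∉ A)
    (hb : b2 A = ((frame H).trace A).card * (A.card - ((frame H).trace A).card : ℕ)) :
    IsFree (insert H A) ∧ IsFree A := by
  obtain ⟨hT, hN⟩ := finrank_map_eq_of_b2_eq hA hH hHA hb
  obtain ⟨θ, hθ, hθ0⟩ := exists_map_ne_zero hT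
  obtain ⟨η, hη, hη0⟩ := exists_map_ne_zero hN
  have hle := (avoids_frame hA hH hHA).card_trace_le
  have hw : wedge θ η ≠ 0 := by
    intro h
    have h1 := congrArg (frame H).res h
    obtain ⟨g, hg⟩ := (isLog_insert.mp hθ.1).1
    rw [wedge, (frame H).det_eq, hg, map_sub, map_mul, map_mul, map_mul, Frame.res_form, zero_mul,
      zero_mul, zero_sub, map_zero, neg_eq_zero] at h1
    exact (mul_ne_zero hθ0 hη0) h1
  have hη' := mulForm_mem (H := H) hη
  refine ⟨⟨_, _, isFreeExp_of_wedge_ne_zero (isLineArr_insert hA hH) hθ.1 hη'.1 hθ.2 hη'.2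
    ?_ ?_⟩, ⟨_, _, isFreeExp_of_wedge_ne_zero hA
      (logDer_anti (Finset.subset_insert H A) _ hθ).1 hη.1 hθ.2 hη.2 ?_ hw⟩⟩
  · rw [Finset.card_insert_of_notMem hHA]
    omega
  · have : wedge θ ((frame H).mulForm η) = (frame H).form * wedge θ η := by
      simp only [wedge, Frame.mulForm_apply, Prod.smul_fst, Prod.smul_snd, smul_eq_mul]
      ring
    rw [this]
    exact mul_ne_zero (frame H).form_ne_zero hw
  · omega

theorem b2_eq_of_chi_eq_zero (hA : IsLineArr A) (hH : IsAffineLine H) (hHA : H ∉ A) {z : ℂ}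
    (h : chi (insert H A) z = 0) (h' : chi A z = 0) :
    b2 A = ((frame H).trace A).card * (A.card - ((frame H).trace A).card : ℕ) := by
  have hle := (avoids_frame hA hH hHA).card_trace_le
  rw [chi, b2_insert hA hH hHA, Finset.card_insert_of_notMem hHA] at h
  rw [chi] at h'
  push_cast at h
  have hz : z = ((frame H).trace A).card := by linear_combination h' - h
  rw [hz] at h'
  push_cast [Nat.cast_sub hle]
  have : ((b2 A : ℤ) : ℂ) = ((((frame H).trace A).card *
      (A.card - ((frame H).trace A).card) : ℤ) : ℂ) := by
    push_cast
    linear_combination h'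
  exact_mod_cast this

theorem exists_chi_eq_zero_of_isFree (hA : IsLineArr A) (hH : IsAffineLine H) (hHA : H ∉ A)
    (h : IsFree (insert H A)) (h' : IsFree A) : ∃ z : ℂ, chi (insert H A) z = 0 ∧ chi A z = 0 := by
  obtain ⟨d₁, d₂, h⟩ := h
  obtain ⟨e₁, e₂, h'⟩ := h'
  have hA' := isLineArr_insert hA hH
  obtain ⟨hd, -⟩ := h.add_eq_and_mul_eq hA'
  obtain ⟨he, -⟩ := h'.add_eq_and_mul_eq hA
  rw [Finset.card_insert_of_notMem hHA] at hd
  obtain ⟨θ, hθ, hθ0⟩ := h.exists_ne_zero hA'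
  have h1 := h'.min_le hA (logDer_anti (Finset.subset_insert H A) _ hθ) hθ0
  obtain ⟨η, hη, hη0⟩ := h'.exists_ne_zero hA
  have h2 := h.min_le hA' (mulForm_mem (H := H) hη)
    ((map_ne_zero_iff _ (frame H).mulForm_injective).mpr hη0)
  have common : (d₁ = e₁ ∨ d₁ = e₂) ∨ (d₂ = e₁ ∨ d₂ = e₂) := by omega
  simp only [h.chi_eq hA', h'.chi_eq hA]
  rcases common with (h | h) | (h | h)
  · exact ⟨d₁, by simp, by simp [h]⟩
  · exact ⟨d₁, by simp, by simp [h]⟩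
  · exact ⟨d₂, by simp, by simp [h]⟩
  · exact ⟨d₂, by simp, by simp [h]⟩

end

/-- **Corollary 1.6** (generalized addition theorem). A deletion pair `(A, A')` of affine
line arrangements is free (i.e. both are free) iff `χ(A,t)` and `χ(A',t)` have a common
root. -/
theorem deletion_pair_free_iff_common_root
    {K : Type*} [Field K] (A A' : Finset (Set (K × K))) (hA : IsLineArr A)
    (hsub : A' ⊆ A) (hcard : A'.card + 1 = A.card) :
    (IsFree A ∧ IsFree A') ↔ ∃ z : ℂ, chi A z = 0 ∧ chi A' z = 0 := by
  classical
  obtain ⟨H, hHA, rfl⟩ : ∃ H, H ∉ A' ∧ insert H A' = A := by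
    obtain ⟨H, hH⟩ := Finset.card_eq_one.mp
      (show (A \ A').card = 1 by rw [Finset.card_sdiff_of_subset hsub]; omega)
    have hmem : H ∈ A \ A' := by rw [hH]; exact Finset.mem_singleton_self H
    refine ⟨H, (Finset.mem_sdiff.mp hmem).2, ?_⟩
    rw [Finset.insert_eq, ← hH, Finset.sdiff_union_of_subset hsub]
  have hA' : IsLineArr A' := fun L hL => hA L (Finset.mem_insert_of_mem hL)
  have hH := hA H (Finset.mem_insert_self H A')
  constructor
  · rintro ⟨h, h'⟩
    convert exists_chi_eq_zero_of_isFree hA' hH hHA (by convert h) h'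
  · rintro ⟨z, h, h'⟩
    convert isFree_pair_of_b2_eq hA' hH hHA
      (b2_eq_of_chi_eq_zero hA' hH hHA (by convert h) h')
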